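/- If w and w' lie in the same orbit O of the W_J-action on W and both w and w' are of minimal length in O, then w ∼_{J,δ} w'. If moreover O ∩ W^J ≠ ∅, then w ≈_{J,δ} w'. -/

import Mathlib

namespace HePaper

variable {I : Type*} {M : CoxeterMatrix I} {W : Type*} [Group W]

/-- The standard parabolic subgroup `W_J` generated by the simple reflections `s_j`, `j ∈ J`. -/
def parabolic (cs : CoxeterSystem M W) (J : Set I) : Subgroup W :=
  Subgroup.closure (cs.simple '' J)

/-- `W^J`, the set of minimal length coset representatives for `W/W_J`. -/
def minRight (cs : CoxeterSystem M W) (J : Set I) : Set W :=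
  {w : W | ∀ j ∈ J, cs.length w < cs.length (w * cs.simple j)}

/-- `^J W`, the set of minimal length coset representatives for `W_J\W`. -/
def minLeft (cs : CoxeterSystem M W) (J : Set I) : Set W :=
  {w : W | ∀ j ∈ J, cs.length w < cs.length (cs.simple j * w)}

/-- `Ad(u)(K) = {k ∈ I : s_k = u s_j u⁻¹ for some j ∈ K}`. -/
def AdSet (cs : CoxeterSystem M W) (u : W) (K : Set I) : Set I :=
  {k : I | ∃ j ∈ K, cs.simple k = u * cs.simple j * u⁻¹}

/-- Membership in the set `T(J, δ)` of sequences `(J_n, w_n)_{n ≥ 0}`. -/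
def InT (cs : CoxeterSystem M W) (J : Set I) (δ : I ≃ I)
    (Jseq : ℕ → Set I) (wseq : ℕ → W) : Prop :=
  Jseq 0 = J ∧
  (∀ n : ℕ, Jseq (n + 1) = Jseq n ∩ AdSet cs (wseq n) (δ '' Jseq n)) ∧
  (∀ n : ℕ, wseq n ∈ minLeft cs (Jseq n) ∩ minRight cs (δ '' Jseq n)) ∧
  (∀ n : ℕ, ∃ x ∈ parabolic cs (Jseq (n + 1)), ∃ y ∈ parabolic cs (δ '' Jseq n),
      wseq (n + 1) = x * wseq n * y)

/-- `I(J, δ; w)`: the largest subset `K ⊆ J` with `Ad(w)(K) = δ(K)`. -/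
def IJdw (cs : CoxeterSystem M W) (J : Set I) (δ : I ≃ I) (w : W) : Set I :=
  ⋃₀ {K : Set I | K ⊆ J ∧ AdSet cs w K = δ '' K}

/-- The orbit of `w` under the `W_J`-action `x · y = δ(x) y x⁻¹`. -/
def orbit (cs : CoxeterSystem M W) (J : Set I) (δW : W ≃* W) (w : W) : Set W :=
  {y : W | ∃ x ∈ parabolic cs J, y = δW x * w * x⁻¹}

/-- The set of elements of minimal length in the orbit of `w`. -/
def orbitMin (cs : CoxeterSystem M W) (J : Set I) (δW : W ≃* W) (w : W) : Set W :=
  {v ∈ orbit cs J δW w | ∀ u ∈ orbit cs J δW w, cs.length v ≤ cs.length u}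

/-- `w →_{s_j} w'` for some `j ∈ J`: `w' = s_{δ(j)} w s_j` and `ℓ(w') ≤ ℓ(w)`. -/
def stepTo (cs : CoxeterSystem M W) (J : Set I) (δ : I ≃ I) (w w' : W) : Prop :=
  ∃ j ∈ J, w' = cs.simple (δ j) * w * cs.simple j ∧ cs.length w' ≤ cs.length w

/-- `w →_{J,δ} w'`. -/
def toRel (cs : CoxeterSystem M W) (J : Set I) (δ : I ≃ I) : W → W → Prop :=
  Relation.ReflTransGen (stepTo cs J δ)

/-- `w` and `w'` are elementarily strongly `(J, δ)`-conjugate. -/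
def ElemStrong (cs : CoxeterSystem M W) (J : Set I) (δW : W ≃* W) (w w' : W) : Prop :=
  cs.length w = cs.length w' ∧
  ∃ x ∈ parabolic cs J, w' = δW x * w * x⁻¹ ∧
    (cs.length (δW x * w) = cs.length x + cs.length w ∨
     cs.length (w * x⁻¹) = cs.length x + cs.length w)

/-- `w ∼_{J,δ} w'`: strongly `(J, δ)`-conjugate. -/
def simRel (cs : CoxeterSystem M W) (J : Set I) (δW : W ≃* W) : W → W → Prop :=
  Relation.ReflTransGen (ElemStrong cs J δW)

/-- The Bruhat order on `W`: some reduced word for `w` contains a subword that is a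
reduced word for `u`. -/
def bruhatLE (cs : CoxeterSystem M W) (u w : W) : Prop :=
  ∃ ω : List I, cs.wordProd ω = w ∧ cs.IsReduced ω ∧
    ∃ ω' : List I, ω'.Sublist ω ∧ cs.wordProd ω' = u ∧ cs.IsReduced ω'

/-- `supp(w)`: the smallest subset `K ⊆ I` with `w ∈ W_K`. -/
def supp (cs : CoxeterSystem M W) (w : W) : Set I :=
  ⋂₀ {K : Set I | w ∈ parabolic cs K}

/-- `supp_δ(w)`: the smallest `δ`-stable subset of `I` containing `supp(w)`. -/
def suppDelta (cs : CoxeterSystem M W) (δ : I ≃ I) (w : W) : Set I :=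
  ⋃ n : ℕ, (⇑δ)^[n] '' supp cs w

/-- `w ≤_{J,δ} w'` for `w, w' ∈ W^J`. -/
def leJd (cs : CoxeterSystem M W) (J : Set I) (δW : W ≃* W) (w w' : W) : Prop :=
  ∀ v' ∈ orbitMin cs J δW w', ∃ v ∈ orbitMin cs J δW w, bruhatLE cs v v'

end HePaper

namespace HePaper

section
open scoped InnerProductSpace
open Filter Topology

/-- A finite reduced symmetric set of nonzero vectors, stable under a linear isometry `g`. -/
structure RootArrangement (V : Type*) [NormedAddCommGroup V] [InnerProductSpace ℝ V] where
  roots : Finset V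
  g : V ≃ₗᵢ[ℝ] V
  zero_notMem : (0 : V) ∉ roots
  neg_mem : ∀ α ∈ roots, -α ∈ roots
  reduced : ∀ α ∈ roots, ∀ β ∈ roots, ∀ c : ℝ, β = c • α → β = α ∨ β = -α
  map_mem : ∀ α ∈ roots, g α ∈ roots

namespace RootArrangement
variable {V : Type*} [NormedAddCommGroup V] [InnerProductSpace ℝ V] (A : RootArrangement V)

theorem symm_mem {α : V} (hα : α ∈ A.roots) : A.g.symm α ∈ A.roots := by
  have hs : Set.SurjOn A.g (A.roots : Set V) (A.roots : Set V) :=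
    Finset.surjOn_of_injOn_of_card_le _ (fun a ha => A.map_mem a ha) A.g.injective.injOn le_rfl
  obtain ⟨β, hβ, rfl⟩ := hs hα
  simpa using hβ

theorem inner_map_right (x y : V) : ⟪x, A.g y⟫_ℝ = ⟪A.g.symm x, y⟫_ℝ := by
  rw [← A.g.inner_map_map (A.g.symm x) y]; simp

theorem inner_symm_right (x y : V) : ⟪x, A.g.symm y⟫_ℝ = ⟪A.g x, y⟫_ℝ := by
  rw [← A.g.inner_map_map x (A.g.symm y)]; simp

/-- `v` lies on no root hyperplane. -/
def Regular (v : V) : Prop := ∀ α ∈ A.roots, ⟪α, v⟫_ℝ ≠ 0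

open Classical in
/-- The roots positive at `v` and negative at `v'`. -/
noncomputable def sep (v v' : V) : Finset V :=
  A.roots.filter fun α => 0 < ⟪α, v⟫_ℝ ∧ ⟪α, v'⟫_ℝ < 0

/-- The number of root hyperplanes separating `v` from `v'`. -/
noncomputable def d (v v' : V) : ℕ := (A.sep v v').card

/-- The displacement of `v` under `g`. -/
noncomputable def len (v : V) : ℕ := A.d v (A.g v)

theorem mem_sep {v v' α : V} :
    α ∈ A.sep v v' ↔ α ∈ A.roots ∧ 0 < ⟪α, v⟫_ℝ ∧ ⟪α, v'⟫_ℝ < 0 := by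
  simp [sep]

theorem d_comm (v v' : V) : A.d v v' = A.d v' v := by
  refine Finset.card_bij (fun α _ => -α) ?_ (fun _ _ _ _ h => neg_injective h) ?_
  · intro α h
    simp only [mem_sep, inner_neg_left] at h ⊢
    exact ⟨A.neg_mem _ h.1, by linarith, by linarith⟩
  · intro α h
    simp only [mem_sep] at h
    refine ⟨-α, ?_, by simp⟩
    simp only [mem_sep, inner_neg_left]
    exact ⟨A.neg_mem _ h.1, by linarith, by linarith⟩

theorem d_triangle {a b c : V} (hb : A.Regular b) : A.d a c ≤ A.d a b + A.d b c := by
  classical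
  refine (Finset.card_le_card (t := A.sep a b ∪ A.sep b c) ?_).trans (Finset.card_union_le _ _)
  intro α h
  simp only [Finset.mem_union, mem_sep] at h ⊢
  rcases lt_or_gt_of_ne (hb α h.1) with h' | h'
  · exact Or.inl ⟨h.1, h.2.1, h'⟩
  · exact Or.inr ⟨h.1, h', h.2.2⟩

theorem d_map (a b : V) : A.d (A.g a) (A.g b) = A.d a b := by
  symm
  refine Finset.card_bij (fun α _ => A.g α) ?_ (fun _ _ _ _ h => A.g.injective h) ?_
  · intro α h
    simp only [mem_sep] at h ⊢
    exact ⟨A.map_mem _ h.1, by simpa using h.2⟩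
  · intro α h
    simp only [mem_sep] at h
    refine ⟨A.g.symm α, ?_, by simp⟩
    simp only [mem_sep, ← inner_map_right]
    exact ⟨A.symm_mem h.1, h.2⟩

theorem len_eq_symm (v : V) : A.len v = A.d v (A.g.symm v) := by
  rw [A.d_comm, ← A.d_map]; simp [len]

/-- The chambers whose closure contains the point `p`. -/
def Star (p v : V) : Prop := A.Regular v ∧ ∀ α ∈ A.roots, 0 < ⟪α, p⟫_ℝ → 0 < ⟪α, v⟫_ℝ

theorem Star.neg {p v α : V} (h : A.Star p v) (hα : α ∈ A.roots) (h' : ⟪α, p⟫_ℝ < 0) :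
    ⟪α, v⟫_ℝ < 0 := by
  have := h.2 (-α) (A.neg_mem α hα) (by simpa using h')
  simpa using this

/-- The signs of `q` are those of `p`, refined by those of `x`. -/
def Refines (p x q : V) : Prop :=
  ∀ α ∈ A.roots, 0 < ⟪α, q⟫_ℝ ↔ 0 < ⟪α, p⟫_ℝ ∨ (⟪α, p⟫_ℝ = 0 ∧ 0 < ⟪α, x⟫_ℝ)

theorem Refines.neg {A : RootArrangement V} {p x q α : V} (h : A.Refines p x q)
    (hα : α ∈ A.roots) :
    ⟪α, q⟫_ℝ < 0 ↔ ⟪α, p⟫_ℝ < 0 ∨ (⟪α, p⟫_ℝ = 0 ∧ ⟪α, x⟫_ℝ < 0) := by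
  simpa using h (-α) (A.neg_mem α hα)

theorem Refines.zero {A : RootArrangement V} {p x q α : V} (h : A.Refines p x q)
    (hα : α ∈ A.roots) :
    ⟪α, q⟫_ℝ = 0 ↔ ⟪α, p⟫_ℝ = 0 ∧ ⟪α, x⟫_ℝ = 0 := by
  have h1 := h α hα
  have h2 := h.neg hα
  rcases lt_trichotomy ⟪α, p⟫_ℝ 0 with h3 | h3 | h3 <;>
  rcases lt_trichotomy ⟪α, x⟫_ℝ 0 with h4 | h4 | h4 <;>
  rcases lt_trichotomy ⟪α, q⟫_ℝ 0 with h5 | h5 | h5 <;> grind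

theorem eventually_sign (α p x : V) : ∀ᶠ ε : ℝ in 𝓝[>] 0,
    (0 < ⟪α, p + ε • x⟫_ℝ ↔ 0 < ⟪α, p⟫_ℝ ∨ (⟪α, p⟫_ℝ = 0 ∧ 0 < ⟪α, x⟫_ℝ)) := by
  have hc : Tendsto (fun ε : ℝ => ⟪α, p + ε • x⟫_ℝ) (𝓝[>] 0) (𝓝 ⟪α, p⟫_ℝ) := by
    have : Continuous fun ε : ℝ => ⟪α, p + ε • x⟫_ℝ := by fun_prop
    simpa using (this.tendsto 0).mono_left nhdsWithin_le_nhds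
  rcases lt_trichotomy ⟪α, p⟫_ℝ 0 with h | h | h
  · filter_upwards [hc.eventually (gt_mem_nhds h)] with ε hε
    constructor
    · intro h'; linarith
    · rintro (h' | ⟨h', _⟩) <;> linarith
  · filter_upwards [self_mem_nhdsWithin] with ε (hε : 0 < ε)
    simp [inner_add_right, inner_smul_right, h, hε]
  · filter_upwards [hc.eventually (lt_mem_nhds h)] with ε hε
    simp [hε, h]

theorem eventually_refines (p x : V) : ∀ᶠ ε : ℝ in 𝓝[>] 0, A.Refines p x (p + ε • x) := by
  have := (Filter.eventually_all_finset A.roots (l := 𝓝[>] (0 : ℝ))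
    (p := fun α ε => (0 < ⟪α, p + ε • x⟫_ℝ ↔
      0 < ⟪α, p⟫_ℝ ∨ (⟪α, p⟫_ℝ = 0 ∧ 0 < ⟪α, x⟫_ℝ)))).2 fun α _ => eventually_sign α p x
  exact this

theorem exists_refines (p x : V) : ∃ q, A.Refines p x q :=
  let ⟨_, h⟩ := (A.eventually_refines p x).exists
  ⟨_, h⟩

theorem Refines.star_iff {A : RootArrangement V} {p x q v : V} (h : A.Refines p x q) :
    A.Star q v ↔ A.Star p v ∧
      ∀ α ∈ A.roots, ⟪α, p⟫_ℝ = 0 → 0 < ⟪α, x⟫_ℝ → 0 < ⟪α, v⟫_ℝ := by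
  constructor
  · intro hv
    exact ⟨⟨hv.1, fun α hα h' => hv.2 α hα ((h α hα).2 (Or.inl h'))⟩,
      fun α hα h0 h' => hv.2 α hα ((h α hα).2 (Or.inr ⟨h0, h'⟩))⟩
  · rintro ⟨h1, h2⟩
    refine ⟨h1.1, fun α hα h' => ?_⟩
    rcases (h α hα).1 h' with h' | h'
    · exact h1.2 α hα h'
    · exact h2 α hα h'.1 h'.2

/-- Refining by a regular vector gives a regular vector. -/
theorem Refines.star {A : RootArrangement V} {p x q : V} (h : A.Refines p x q)
    (hx : A.Regular x) : A.Star p q :=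
  ⟨fun α hα h0 => hx α hα ((h.zero hα).1 h0).2, fun α hα h' => (h α hα).2 (Or.inl h')⟩

/-- `u'` is obtained from `u` by crossing the wall of the root `β`. -/
structure Cross (β u u' : V) : Prop where
  mem : β ∈ A.roots
  pos : 0 < ⟪β, u⟫_ℝ
  neg : ⟪β, u'⟫_ℝ < 0
  regular : A.Regular u
  regular' : A.Regular u'
  same : ∀ α ∈ A.roots, α ≠ β → α ≠ -β → (0 < ⟪α, u⟫_ℝ ↔ 0 < ⟪α, u'⟫_ℝ)

theorem exists_forall_inner_ne_zero (Γ : Finset V) (h0 : (0 : V) ∉ Γ) :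
    ∃ z : V, ∀ γ ∈ Γ, ⟪γ, z⟫_ℝ ≠ 0 := by
  classical
  induction Γ using Finset.induction_on with
  | empty => exact ⟨0, by simp⟩
  | insert a s _ ih =>
    simp only [Finset.mem_insert, not_or] at h0
    obtain ⟨z, hz⟩ := ih h0.2
    have h1 : ∀ γ ∈ insert a s, ∀ᶠ ε : ℝ in 𝓝[>] 0, ⟪γ, z + ε • a⟫_ℝ ≠ 0 := by
      intro γ hγ
      filter_upwards [eventually_sign γ z a, eventually_sign (-γ) z a] with ε h1 h2 h3
      simp only [inner_neg_left, h3] at h1 h2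
      rcases Finset.mem_insert.1 hγ with rfl | hγ
      · have := real_inner_self_pos.2 (Ne.symm h0.1)
        rcases lt_trichotomy ⟪γ, z⟫_ℝ 0 with h | h | h <;> grind
      · have := hz γ hγ
        rcases lt_trichotomy ⟪γ, z⟫_ℝ 0 with h | h | h <;> grind
    obtain ⟨ε, hε⟩ := ((Filter.eventually_all_finset _).2 h1).exists
    exact ⟨_, hε⟩

theorem exists_cross {v y : V} (hv : A.Regular v)
    (hne : ∃ α ∈ A.roots, 0 < ⟪α, v⟫_ℝ ∧ ⟪α, y⟫_ℝ < 0) :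
    ∃ β v', A.Cross β v v' ∧ ⟪β, y⟫_ℝ < 0 := by
  classical
  set S := A.sep v y with hS
  have hSne : S.Nonempty := by
    obtain ⟨α, h⟩ := hne
    exact ⟨α, A.mem_sep.2 h⟩
  let γ : V × V → V := fun ab => ⟪ab.2, y⟫_ℝ • ab.1 - ⟪ab.1, y⟫_ℝ • ab.2
  let Γ : Finset V := S.offDiag.image γ
  have hΓ : (0 : V) ∉ Γ := by
    simp only [Γ, Finset.mem_image, Finset.mem_offDiag, Prod.exists, not_exists, not_and]
    rintro a b ⟨ha, hb, hab⟩ h0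
    rw [hS, mem_sep] at ha hb
    have hb' : b = (⟪b, y⟫_ℝ / ⟪a, y⟫_ℝ) • a := by
      have h1 : ⟪b, y⟫_ℝ • a = ⟪a, y⟫_ℝ • b := sub_eq_zero.1 h0
      rw [div_eq_inv_mul, mul_smul, h1, smul_smul, inv_mul_cancel₀ ha.2.2.ne, one_smul]
    rcases A.reduced a ha.1 b hb.1 _ hb' with h | h
    · exact hab h.symm
    · have := hb.2.1
      rw [h, inner_neg_left] at this
      linarith [ha.2.1]
  obtain ⟨z, hz⟩ := exists_forall_inner_ne_zero Γ hΓ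
  obtain ⟨ε, h1, h2⟩ := ((A.eventually_refines v z).and ((Filter.eventually_all_finset Γ).2
    fun γ _ => (eventually_sign γ v z).and (eventually_sign (-γ) v z))).exists
  set v0 := v + ε • z with hv0
  have hpos : ∀ α ∈ A.roots, (0 < ⟪α, v0⟫_ℝ ↔ 0 < ⟪α, v⟫_ℝ) := fun α hα => by
    rw [h1 α hα]; have := hv α hα; tauto
  have hv0r : A.Regular v0 := fun α hα h0 => hv α hα ((h1.zero hα).1 h0).1
  have hΓ0 : ∀ γ ∈ Γ, ⟪γ, v0⟫_ℝ ≠ 0 := by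
    intro γ hγ h0
    have h3 := h2 γ hγ
    have := hz γ hγ
    simp only [inner_neg_left, h0] at h3
    rcases lt_trichotomy ⟪γ, v⟫_ℝ 0 with h | h | h <;> grind
  let r : V → ℝ := fun α => ⟪α, v0⟫_ℝ / (-⟪α, y⟫_ℝ)
  obtain ⟨β, hβS, hβ⟩ := S.exists_min_image r hSne
  have hβ' := A.mem_sep.1 hβS
  set w0 := v0 + r β • y with hw0
  have hrpos : 0 < r β := div_pos ((hpos β hβ'.1).2 hβ'.2.1) (by linarith [hβ'.2.2])
  have hβ0 : ⟪β, w0⟫_ℝ = 0 := by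
    have := hβ'.2.2.ne
    simp only [hw0, inner_add_right, inner_smul_right, r]
    field_simp
    ring
  have key : ∀ α ∈ A.roots, α ≠ β → 0 < ⟪α, v⟫_ℝ → 0 < ⟪α, w0⟫_ℝ := by
    intro α hα hne hαv
    have hα0 := (hpos α hα).2 hαv
    simp only [hw0, inner_add_right, inner_smul_right]
    by_cases hy : ⟪α, y⟫_ℝ < 0
    · have hαS : α ∈ S := A.mem_sep.2 ⟨hα, hαv, hy⟩
      have hle := hβ α hαS
      have hne' : r β ≠ r α := by
        intro heq
        refine hΓ0 (γ (α, β)) (Finset.mem_image_of_mem _ (by simp [hαS, hβS, hne])) ?_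
        simp only [γ, inner_sub_left, inner_smul_left, r] at heq ⊢
        have h3 := hβ'.2.2.ne
        have h4 := hy.ne
        field_simp at heq
        simp only [conj_trivial]
        linarith
      have hlt : r β < r α := lt_of_le_of_ne hle hne'
      have : r α * (-⟪α, y⟫_ℝ) = ⟪α, v0⟫_ℝ := div_mul_cancel₀ _ (by linarith)
      nlinarith
    · push Not at hy
      have := mul_nonneg hrpos.le hy
      linarith
  have key' : ∀ α ∈ A.roots, α ≠ β → α ≠ -β → (0 < ⟪α, v⟫_ℝ ↔ 0 < ⟪α, w0⟫_ℝ) := by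
    intro α hα h3 h4
    refine ⟨key α hα h3, fun h5 => ?_⟩
    by_contra h6
    have h7 : 0 < ⟪-α, v⟫_ℝ := by
      rw [inner_neg_left]
      have := lt_of_le_of_ne (not_lt.1 h6) (hv α hα)
      linarith
    have := key (-α) (A.neg_mem α hα) (fun h => h4 (by rw [← h, neg_neg])) h7
    rw [inner_neg_left] at this
    linarith
  have hw0ne : ∀ α ∈ A.roots, α ≠ β → α ≠ -β → ⟪α, w0⟫_ℝ ≠ 0 := by
    intro α hα h3 h4 h5
    have h6 := (key' α hα h3 h4).not.2 (by rw [h5]; exact lt_irrefl _)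
    have h7 := (key' (-α) (A.neg_mem α hα) (fun h => h4 (by rw [← h, neg_neg]))
      (fun h => h3 (neg_injective h))).not.2 (by simp [h5])
    simp only [inner_neg_left] at h7
    have := hv α hα
    grind
  obtain ⟨v', hv'⟩ := A.exists_refines w0 y
  have hv'β : ⟪β, v'⟫_ℝ < 0 := (hv'.neg hβ'.1).2 (Or.inr ⟨hβ0, hβ'.2.2⟩)
  refine ⟨β, v', ⟨hβ'.1, hβ'.2.1, hv'β, hv, ?_, ?_⟩, hβ'.2.2⟩
  · intro α hα h0
    by_cases h3 : α = β
    · subst h3; linarith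
    by_cases h4 : α = -β
    · subst h4; rw [inner_neg_left] at h0; linarith
    exact hw0ne α hα h3 h4 ((hv'.zero hα).1 h0).1
  · intro α hα h3 h4
    rw [key' α hα h3 h4, hv' α hα]
    have := hw0ne α hα h3 h4
    tauto

end RootArrangement

end

section
open scoped InnerProductSpace
open Filter Topology
namespace RootArrangement
variable {V : Type*} [NormedAddCommGroup V] [InnerProductSpace ℝ V] {A : RootArrangement V}

theorem Cross.d_left {β u u' x : V} (h : A.Cross β u u') (hx : ⟪β, x⟫_ℝ < 0) :
    A.d u x = A.d u' x + 1 := by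
  classical
  have : A.sep u x = insert β (A.sep u' x) := by
    ext α
    simp only [Finset.mem_insert, mem_sep]
    by_cases h1 : α = β
    · subst h1; simp [h.mem, h.pos, hx]
    by_cases h2 : α = -β
    · subst h2
      simp only [h1, inner_neg_left, false_or]
      constructor <;> rintro ⟨_, _, _⟩ <;> linarith
    by_cases h3 : α ∈ A.roots
    · simp [h1, h.same α h3 h1 h2]
    · simp [h1, h3]
  rw [d, this, Finset.card_insert_of_notMem, d]
  rw [mem_sep]
  intro h4
  linarith [h.neg, h4.2.1]

theorem Cross.d_eq_one {β u u' : V} (h : A.Cross β u u') : A.d u u' = 1 := by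
  rw [h.d_left h.neg, d, Nat.add_eq_right, Finset.card_eq_zero, Finset.eq_empty_iff_forall_notMem]
  intro α hα
  have := (A.mem_sep.1 hα).2
  linarith

theorem Cross.star {β u u' p : V} (h : A.Cross β u u') (hu : A.Star p u) (hp : ⟪β, p⟫_ℝ = 0) :
    A.Star p u' := by
  refine ⟨h.regular', fun α hα h1 => ?_⟩
  by_cases h2 : α = β
  · subst h2; linarith
  by_cases h3 : α = -β
  · subst h3; rw [inner_neg_left] at h1; linarith
  exact (h.same α hα h2 h3).1 (hu.2 α hα h1)

theorem Regular.map {v : V} (h : A.Regular v) : A.Regular (A.g v) := fun α hα => by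
  rw [inner_map_right]; exact h _ (A.symm_mem hα)

theorem Regular.symm {v : V} (h : A.Regular v) : A.Regular (A.g.symm v) := fun α hα => by
  rw [inner_symm_right]; exact h _ (A.map_mem _ hα)

theorem d_symm_map (a b : V) : A.d (A.g.symm a) (A.g.symm b) = A.d a b := by
  rw [← A.d_map]; simp

theorem Cross.len_le {β u u' : V} (h : A.Cross β u u')
    (hg : ⟪β, A.g u⟫_ℝ < 0 ∨ ⟪β, A.g.symm u⟫_ℝ < 0) : A.len u' ≤ A.len u := by
  rcases hg with hg | hg
  · have h1 := h.d_left hg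
    have h2 := A.d_triangle (a := u') (c := A.g u') h.regular.map
    rw [A.d_map, h.d_eq_one] at h2
    rw [len, len]; lia
  · have h1 := h.d_left hg
    have h2 := A.d_triangle (a := u') (c := A.g.symm u') h.regular.symm
    rw [A.d_symm_map, h.d_eq_one] at h2
    rw [len_eq_symm, len_eq_symm]; lia

variable (A)

/-- A step between equal or adjacent chambers of the star of `p`, not increasing `len`. -/
def Cyc (p v v' : V) : Prop :=
  A.Star p v ∧ A.Star p v' ∧ A.d v v' ≤ 1 ∧ A.len v' ≤ A.len v

/-- Elementary strong conjugacy for chambers of the star of `p`. -/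
def Elem (p v v' : V) : Prop :=
  A.Star p v ∧ A.Star p v' ∧ A.len v = A.len v' ∧
    (A.d v v' ≤ 1 ∨ A.d v (A.g v') = A.len v + A.d v v' ∨ A.d v' (A.g v) = A.len v' + A.d v' v)

/-- Strong conjugacy for chambers of the star of `p`. -/
def Rel (p : V) : V → V → Prop := Relation.ReflTransGen (A.Elem p)

/-- `v` has minimal displacement among the chambers of the star of `p`. -/
def IsMin (p v : V) : Prop := A.Star p v ∧ ∀ u, A.Star p u → A.len v ≤ A.len u

variable {A}

theorem Elem.symm {p v v' : V} (h : A.Elem p v v') : A.Elem p v' v := by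
  obtain ⟨h1, h2, h3, h4⟩ := h
  refine ⟨h2, h1, h3.symm, ?_⟩
  rw [A.d_comm v' v] at *
  tauto

theorem Rel.symm {p v v' : V} (h : A.Rel p v v') : A.Rel p v' v := by
  induction h with
  | refl => exact .refl
  | tail _ h2 ih => exact .head h2.symm ih

theorem Rel.star {p v v' : V} (h : A.Rel p v v') (hv : A.Star p v) : A.Star p v' := by
  induction h with
  | refl => exact hv
  | tail _ h2 _ => exact h2.2.1

theorem Rel.len {p v v' : V} (h : A.Rel p v v') : A.len v = A.len v' := by
  induction h with
  | refl => rfl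
  | tail _ h2 ih => exact ih.trans h2.2.2.1

theorem Rel.mono {p q v v' : V} (h : A.Rel q v v') (hpq : ∀ u, A.Star q u → A.Star p u) :
    A.Rel p v v' :=
  Relation.ReflTransGen.mono (fun _ _ hab => ⟨hpq _ hab.1, hpq _ hab.2.1, hab.2.2⟩) _ _ h

theorem IsMin.rel {p v v' : V} (h : A.IsMin p v) (hr : A.Rel p v v') : A.IsMin p v' :=
  ⟨hr.star h.1, fun u hu => hr.len ▸ h.2 u hu⟩

theorem IsMin.mono {p q v : V} (h : A.IsMin p v) (hv : A.Star q v)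
    (hpq : ∀ u, A.Star q u → A.Star p u) : A.IsMin q v :=
  ⟨hv, fun u hu => h.2 u (hpq u hu)⟩

theorem cyc_mono {p q v v' : V} (h : Relation.ReflTransGen (A.Cyc q) v v')
    (hpq : ∀ u, A.Star q u → A.Star p u) : Relation.ReflTransGen (A.Cyc p) v v' :=
  Relation.ReflTransGen.mono (fun _ _ hab => ⟨hpq _ hab.1, hpq _ hab.2.1, hab.2.2⟩) _ _ h

theorem IsMin.rel_of_cyc {p v v' : V} (h : A.IsMin p v)
    (hc : Relation.ReflTransGen (A.Cyc p) v v') : A.Rel p v v' := by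
  induction hc with
  | refl => exact .refl
  | tail _ h2 ih =>
    have h3 := (h.rel ih).2 _ h2.2.1
    exact ih.tail ⟨h2.1, h2.2.1, le_antisymm h3 h2.2.2.2, Or.inl h2.2.2.1⟩

/-- If crossing walls through `p` in the direction of `y` never increases `len`, every chamber of
the star of `p` can be moved into the star of a refinement of `p` by `y`. -/
theorem exists_cyc_star {p y q : V} (hq : A.Refines p y q)
    (H : ∀ u β, A.Star p u → β ∈ A.roots → ⟪β, p⟫_ℝ = 0 → 0 < ⟪β, u⟫_ℝ → ⟪β, y⟫_ℝ < 0 →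
      ⟪β, A.g u⟫_ℝ < 0 ∨ ⟪β, A.g.symm u⟫_ℝ < 0) {v : V} (hv : A.Star p v) :
    ∃ v', A.Star q v' ∧ Relation.ReflTransGen (A.Cyc p) v v' := by
  induction hn : A.d v q using Nat.strong_induction_on generalizing v with
  | _ n ih =>
    by_cases hne : ∃ α ∈ A.roots, 0 < ⟪α, v⟫_ℝ ∧ ⟪α, q⟫_ℝ < 0
    · obtain ⟨β, v', hc, hβ⟩ := A.exists_cross hv.1 hne
      have hβp : ⟪β, p⟫_ℝ = 0 ∧ ⟪β, y⟫_ℝ < 0 := by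
        rcases (hq.neg hc.mem).1 hβ with h | h
        · have := hv.neg _ hc.mem h
          linarith [hc.pos]
        · exact h
      have hv' := hc.star hv hβp.1
      obtain ⟨v'', h1, h2⟩ := ih (A.d v' q) (by have := hc.d_left hβ; lia) hv' rfl
      exact ⟨v'', h1, .head ⟨hv, hv', hc.d_eq_one.le,
        hc.len_le (H v β hv hc.mem hβp.1 hc.pos hβp.2)⟩ h2⟩
    · refine ⟨v, ⟨hv.1, fun α hα h => ?_⟩, .refl⟩
      by_contra h1
      refine hne ⟨-α, A.neg_mem α hα, ?_, by simpa using h⟩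
      have := hv.1 α hα
      rw [inner_neg_left]
      grind

variable (A) in
open Classical in
/-- The roots orthogonal to `p`. -/
noncomputable def rootsAt (p : V) : Finset V := A.roots.filter fun α => ⟪α, p⟫_ℝ = 0

theorem mem_rootsAt {p α : V} : α ∈ A.rootsAt p ↔ α ∈ A.roots ∧ ⟪α, p⟫_ℝ = 0 := by
  simp [rootsAt]

variable (A) in
/-- `g` preserves the set of roots orthogonal to `p`. -/
def Stable (p : V) : Prop := ∀ α ∈ A.rootsAt p, A.g α ∈ A.rootsAt p

theorem Stable.symm {p α : V} (h : A.Stable p) (hα : α ∈ A.rootsAt p) :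
    A.g.symm α ∈ A.rootsAt p := by
  have hs : Set.SurjOn A.g (A.rootsAt p : Set V) (A.rootsAt p : Set V) :=
    Finset.surjOn_of_injOn_of_card_le _ h A.g.injective.injOn le_rfl
  obtain ⟨β, hβ, rfl⟩ := hs hα
  simpa using hβ

theorem stable_of_symm {p : V} (h : ∀ α ∈ A.rootsAt p, A.g.symm α ∈ A.rootsAt p) :
    A.Stable p := by
  intro α hα
  have hs : Set.SurjOn A.g.symm (A.rootsAt p : Set V) (A.rootsAt p : Set V) :=
    Finset.surjOn_of_injOn_of_card_le _ h A.g.symm.injective.injOn le_rfl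
  obtain ⟨β, hβ, rfl⟩ := hs hα
  simpa using hβ

theorem Refines.rootsAt_subset {p x q : V} (h : A.Refines p x q) :
    A.rootsAt q ⊆ A.rootsAt p := fun α hα => by
  rw [mem_rootsAt] at *
  exact ⟨hα.1, ((h.zero hα.1).1 hα.2).1⟩

theorem Refines.card_lt {p x q α : V} (h : A.Refines p x q) (hα : α ∈ A.rootsAt p)
    (hx : ⟪α, x⟫_ℝ ≠ 0) : (A.rootsAt q).card < (A.rootsAt p).card := by
  refine Finset.card_lt_card ⟨h.rootsAt_subset, fun hs => hx ?_⟩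
  have := mem_rootsAt.1 (hs hα)
  exact ((h.zero this.1).1 this.2).2

theorem Refines.star_mono {p x q : V} (h : A.Refines p x q) (u : V) (hu : A.Star q u) :
    A.Star p u := (h.star_iff.1 hu).1

/-- Off the roots at a stable `p`, all chambers of the star of `p` look alike. -/
theorem Star.pos_iff {p v : V} (hv : A.Star p v) {α : V} (hα : α ∈ A.roots)
    (hp : ⟪α, p⟫_ℝ ≠ 0) : 0 < ⟪α, v⟫_ℝ ↔ 0 < ⟪α, p⟫_ℝ := by
  refine ⟨fun h => ?_, hv.2 α hα⟩
  by_contra h1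
  have := hv.neg A hα (lt_of_le_of_ne (not_lt.1 h1) hp)
  linarith

theorem Star.map_pos_iff {p v : V} (hs : A.Stable p) (hv : A.Star p v) {α : V} (hα : α ∈ A.roots)
    (hp : ⟪α, p⟫_ℝ ≠ 0) : 0 < ⟪α, A.g v⟫_ℝ ↔ 0 < ⟪α, A.g p⟫_ℝ := by
  rw [inner_map_right, inner_map_right]
  refine hv.pos_iff (A.symm_mem hα) fun h => hp ?_
  have := hs _ (mem_rootsAt.2 ⟨A.symm_mem hα, h⟩)
  simpa using (mem_rootsAt.1 this).2

theorem Regular.neg_iff {v : V} (h : A.Regular v) {α : V} (hα : α ∈ A.roots) :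
    ⟪α, v⟫_ℝ < 0 ↔ ¬ 0 < ⟪α, v⟫_ℝ := by
  have := h α hα; grind

/-- Every chamber of the star of `p` can be moved by steps not increasing `len` into the star of a
stable point `q` refining `p`, whose star also contains a given chamber `z` with `z` and `g⁻¹ z`
on the same side of all roots at `p`. -/
theorem exists_cyc_stable {p z v : V} (hz : A.Star p z)
    (hzp : ∀ α ∈ A.rootsAt p, 0 < ⟪α, A.g.symm z⟫_ℝ → 0 < ⟪α, z⟫_ℝ) (hv : A.Star p v) :
    ∃ q v', A.rootsAt q ⊆ A.rootsAt p ∧ A.Stable q ∧ (∀ u, A.Star q u → A.Star p u) ∧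
      A.Star q z ∧ A.Star q v' ∧ Relation.ReflTransGen (A.Cyc p) v v' := by
  induction hn : (A.rootsAt p).card using Nat.strong_induction_on generalizing p v with
  | _ n ih =>
    by_cases hs : A.Stable p
    · exact ⟨p, v, subset_rfl, hs, fun _ h => h, hz, hv, .refl⟩
    obtain ⟨q, hq⟩ := A.exists_refines p (A.g.symm p)
    obtain ⟨v1, hv1, hc⟩ := exists_cyc_star hq (fun u β hu hβ _ _ hy => by
      right
      rw [inner_symm_right] at hy ⊢
      exact hu.neg A (A.map_mem β hβ) hy) hv
    have hzq : A.Star q z := by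
      refine hq.star_iff.2 ⟨hz, fun α hα h0 hpos => hzp α (mem_rootsAt.2 ⟨hα, h0⟩) ?_⟩
      rw [inner_symm_right] at hpos ⊢
      exact hz.2 _ (A.map_mem α hα) hpos
    have hlt : (A.rootsAt q).card < n := by
      rw [← hn]
      simp only [Stable, not_forall] at hs
      obtain ⟨α, hα, h⟩ := hs
      refine hq.card_lt hα fun h0 => h (mem_rootsAt.2 ⟨A.map_mem α (mem_rootsAt.1 hα).1, ?_⟩)
      rwa [inner_symm_right] at h0
    obtain ⟨q', v', h1, h2, h3, h4, h5, h6⟩ := ih _ hlt hzq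
      (fun α hα => hzp α (hq.rootsAt_subset hα)) hv1 rfl
    exact ⟨q', v', h1.trans hq.rootsAt_subset, h2, fun u hu => hq.star_mono u (h3 u hu), h4, h5,
      hc.trans (cyc_mono h6 hq.star_mono)⟩

/-- In the situation of `exists_cyc_stable`, a chamber of minimal displacement is moved to one that
`g` moves, like `z`, across no wall through `q`. -/
theorem exists_cyc_stable_of_isMin {p z v : V} (hz : A.Star p z)
    (hzp : ∀ α ∈ A.rootsAt p, 0 < ⟪α, A.g.symm z⟫_ℝ → 0 < ⟪α, z⟫_ℝ) (hv : A.IsMin p v) :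
    ∃ q v', A.Stable q ∧ (∀ u, A.Star q u → A.Star p u) ∧
      A.Star q z ∧ A.Star q v' ∧ Relation.ReflTransGen (A.Cyc p) v v' ∧
      (∀ α ∈ A.rootsAt q, 0 < ⟪α, A.g z⟫_ℝ ↔ 0 < ⟪α, z⟫_ℝ) ∧
      (∀ α ∈ A.rootsAt q, 0 < ⟪α, A.g v'⟫_ℝ ↔ 0 < ⟪α, v'⟫_ℝ) := by
  classical
  obtain ⟨q, v', h1, h2, h3, h4, h5, h6⟩ := exists_cyc_stable hz hzp hv.1
  have hneg : ∀ {x α : V}, α ∈ A.rootsAt x → -α ∈ A.rootsAt x := fun {x α} hα => by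
    rw [mem_rootsAt] at hα ⊢
    exact ⟨A.neg_mem α hα.1, by simp [hα.2]⟩
  have hzz : ∀ α ∈ A.rootsAt q, 0 < ⟪α, A.g z⟫_ℝ ↔ 0 < ⟪α, z⟫_ℝ := by
    have aux : ∀ α ∈ A.rootsAt q, 0 < ⟪α, z⟫_ℝ → 0 < ⟪α, A.g z⟫_ℝ := by
      intro α hα h
      rw [inner_map_right]
      refine hzp _ (h1 (h2.symm hα)) ?_
      simpa using h
    intro α hα
    refine ⟨fun h => ?_, aux α hα⟩
    by_contra h'
    have h7 := (h4.1.neg_iff (mem_rootsAt.1 hα).1).2 h'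
    have := aux (-α) (hneg hα) (by simpa using h7)
    rw [inner_neg_left] at this
    linarith
  refine ⟨q, v', h2, h3, h4, h5, h6, hzz, ?_⟩
  have hmin := hv.rel (hv.rel_of_cyc h6)
  have hsub : A.sep z (A.g z) ⊆ A.sep v' (A.g v') := by
    intro α hα
    rw [mem_sep] at hα ⊢
    have hq : ⟪α, q⟫_ℝ ≠ 0 := fun h0 => by
      have := (hzz α (mem_rootsAt.2 ⟨hα.1, h0⟩)).2 hα.2.1
      linarith [hα.2.2]
    rw [h4.pos_iff hα.1 hq, h4.1.map.neg_iff hα.1, h4.map_pos_iff h2 hα.1 hq] at hα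
    rwa [h5.pos_iff hα.1 hq, h5.1.map.neg_iff hα.1, h5.map_pos_iff h2 hα.1 hq]
  have heq := Finset.eq_of_subset_of_card_le hsub (hmin.2 z hz)
  have key : ∀ α ∈ A.rootsAt q, 0 < ⟪α, v'⟫_ℝ → 0 < ⟪α, A.g v'⟫_ℝ := by
    intro α hα h7
    by_contra h8
    have hα' := (mem_rootsAt.1 hα).1
    have h9 : α ∈ A.sep z (A.g z) := by
      rw [heq, mem_sep]
      exact ⟨hα', h7, (h5.1.map.neg_iff hα').2 h8⟩
    rw [mem_sep] at h9
    have := (hzz α hα).2 h9.2.1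
    linarith [h9.2.2]
  intro α hα
  refine ⟨fun h => ?_, key α hα⟩
  by_contra h'
  have h7 := (h5.1.neg_iff (mem_rootsAt.1 hα).1).2 h'
  have := key (-α) (hneg hα) (by simpa using h7)
  rw [inner_neg_left] at this
  linarith

end RootArrangement

end

section
open scoped InnerProductSpace
open Filter Topology
namespace RootArrangement
variable {V : Type*} [NormedAddCommGroup V] [InnerProductSpace ℝ V] {A : RootArrangement V}

variable (A) in
/-- The linear span of the roots orthogonal to `p`. -/
def rootSpan (p : V) : Submodule ℝ V := Submodule.span ℝ (A.rootsAt p)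

variable (A) in
/-- The self-adjoint operator `g + g⁻¹`. -/
noncomputable def T : V →ₗ[ℝ] V :=
  (A.g.toLinearEquiv : V →ₗ[ℝ] V) + (A.g.symm.toLinearEquiv : V →ₗ[ℝ] V)

theorem T_apply (x : V) : A.T x = A.g x + A.g.symm x := rfl

variable (A) in
/-- The `l`-eigenspace of `g + g⁻¹` on the span of the roots orthogonal to `p`. -/
noncomputable def eig (p : V) (l : ℝ) : Submodule ℝ V :=
  A.rootSpan p ⊓ Module.End.eigenspace A.T l

theorem mem_eig {p x : V} {l : ℝ} : x ∈ A.eig p l ↔ x ∈ A.rootSpan p ∧ A.T x = l • x := by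
  simp [eig]

theorem inner_T_comm (x y : V) : ⟪x, A.T y⟫_ℝ = ⟪A.T x, y⟫_ℝ := by
  simp only [T_apply, inner_add_right, inner_add_left, inner_map_right, inner_symm_right]
  ring

theorem inner_self_T (x : V) : ⟪x, A.T x⟫_ℝ = 2 * ⟪x, A.g x⟫_ℝ := by
  rw [T_apply, inner_add_right, inner_symm_right, real_inner_comm x (A.g x)]
  ring

theorem inner_T_T (x : V) : ⟪A.T x, A.T x⟫_ℝ = 2 * ⟪A.g x, A.T x⟫_ℝ := by
  have h1 : ⟪A.g x, A.g x⟫_ℝ = ⟪A.g.symm x, A.g.symm x⟫_ℝ := by simp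
  have h2 := real_inner_comm (A.g x) (A.g.symm x)
  simp only [T_apply, inner_add_right, inner_add_left]
  linarith

theorem Stable.g_mem {p x : V} (h : A.Stable p) (hx : x ∈ A.rootSpan p) :
    A.g x ∈ A.rootSpan p := by
  induction hx using Submodule.span_induction with
  | mem x hx => exact Submodule.subset_span (h x hx)
  | zero => simp
  | add x y _ _ h1 h2 => rw [map_add]; exact add_mem h1 h2
  | smul a x _ h1 => rw [map_smul]; exact Submodule.smul_mem _ _ h1

theorem Stable.symm_mem {p x : V} (h : A.Stable p) (hx : x ∈ A.rootSpan p) :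
    A.g.symm x ∈ A.rootSpan p := by
  induction hx using Submodule.span_induction with
  | mem x hx => exact Submodule.subset_span (h.symm hx)
  | zero => simp
  | add x y _ _ h1 h2 => rw [map_add]; exact add_mem h1 h2
  | smul a x _ h1 => rw [map_smul]; exact Submodule.smul_mem _ _ h1

theorem Stable.T_mem {p x : V} (h : A.Stable p) (hx : x ∈ A.rootSpan p) :
    A.T x ∈ A.rootSpan p := add_mem (h.g_mem hx) (h.symm_mem hx)

theorem inner_eq_zero_of_mem_rootSpan {p x y : V} (hx : x ∈ A.rootSpan p)
    (h : ∀ α ∈ A.rootsAt p, ⟪α, y⟫_ℝ = 0) : ⟪x, y⟫_ℝ = 0 := by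
  induction hx using Submodule.span_induction with
  | mem x hx => exact h x hx
  | zero => simp
  | add x y _ _ h1 h2 => rw [inner_add_left, h1, h2, add_zero]
  | smul a x _ h1 => rw [inner_smul_left, h1, mul_zero]

theorem exists_inner_ne_zero {p x : V} (hx : x ∈ A.rootSpan p) (h0 : x ≠ 0) :
    ∃ α ∈ A.rootsAt p, ⟪α, x⟫_ℝ ≠ 0 := by
  by_contra! h
  exact h0 (inner_self_eq_zero (𝕜 := ℝ).1 (inner_eq_zero_of_mem_rootSpan hx h))

theorem inner_T_add_smul (x y : V) (t : ℝ) : ⟪x + t • y, A.T (x + t • y)⟫_ℝ =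
    ⟪x, A.T x⟫_ℝ + t * (2 * ⟪y, A.T x⟫_ℝ) + t ^ 2 * ⟪y, A.T y⟫_ℝ := by
  have : ⟪x, A.T y⟫_ℝ = ⟪y, A.T x⟫_ℝ := by rw [inner_T_comm, real_inner_comm]
  simp only [map_add, map_smul, inner_add_left, inner_add_right, inner_smul_left,
    inner_smul_right, this, conj_trivial]
  ring

theorem inner_add_smul_self (x y : V) (t : ℝ) : ⟪x + t • y, x + t • y⟫_ℝ =
    ⟪x, x⟫_ℝ + t * (2 * ⟪y, x⟫_ℝ) + t ^ 2 * ⟪y, y⟫_ℝ := by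
  have : ⟪x, y⟫_ℝ = ⟪y, x⟫_ℝ := real_inner_comm _ _
  simp only [inner_add_left, inner_add_right, inner_smul_left,
    inner_smul_right, this, conj_trivial]
  ring

theorem inner_T_le_of_eventually {x y : V} {m : ℝ} (hx : ⟪x, A.T x⟫_ℝ = m * ⟪x, x⟫_ℝ)
    (h : ∀ᶠ t : ℝ in 𝓝[>] 0,
      ⟪x + t • y, A.T (x + t • y)⟫_ℝ ≤ m * ⟪x + t • y, x + t • y⟫_ℝ) :
    ⟪y, A.T x⟫_ℝ ≤ m * ⟪y, x⟫_ℝ := by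
  have hc : Tendsto (fun t : ℝ => 2 * ⟪y, A.T x⟫_ℝ + t * ⟪y, A.T y⟫_ℝ
      - m * (2 * ⟪y, x⟫_ℝ + t * ⟪y, y⟫_ℝ)) (𝓝[>] 0)
      (𝓝 (2 * ⟪y, A.T x⟫_ℝ - m * (2 * ⟪y, x⟫_ℝ))) := by
    have : Continuous (fun t : ℝ => 2 * ⟪y, A.T x⟫_ℝ + t * ⟪y, A.T y⟫_ℝ
      - m * (2 * ⟪y, x⟫_ℝ + t * ⟪y, y⟫_ℝ)) := by fun_prop
    simpa using (this.tendsto 0).mono_left (nhdsWithin_le_nhds (s := Set.Ioi 0))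
  have := le_of_tendsto hc (b := 0) (by
    filter_upwards [h, self_mem_nhdsWithin] with t ht (ht0 : 0 < t)
    rw [inner_T_add_smul, inner_add_smul_self, hx] at ht
    by_contra hneg
    push Not at hneg
    have := mul_pos ht0 hneg
    nlinarith)
  linarith

theorem le_of_eventually {x y : V} {l m : ℝ} (hx : A.T x = m • x) (hy : A.T y = l • y)
    (hy0 : y ≠ 0) (h : ∃ᶠ t : ℝ in 𝓝[>] 0,
      ⟪x + t • y, A.T (x + t • y)⟫_ℝ ≤ m * ⟪x + t • y, x + t • y⟫_ℝ) : l ≤ m := by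
  obtain ⟨t, ht, ht0⟩ := (h.and_eventually self_mem_nhdsWithin).exists
  have ht0 : 0 < t := ht0
  rw [inner_T_add_smul, inner_add_smul_self, hx, hy] at ht
  simp only [inner_smul_right] at ht
  have h1 : 0 < t ^ 2 * ⟪y, y⟫_ℝ := mul_pos (pow_pos ht0 2) (real_inner_self_pos.2 hy0)
  by_contra! hlt
  nlinarith

variable (A) in
/-- With respect to the roots at `p`, the point `x` lies in the closure of the chamber of `u`. -/
def InClosure (p u x : V) : Prop := ∀ α ∈ A.rootsAt p, 0 < ⟪α, u⟫_ℝ → 0 ≤ ⟪α, x⟫_ℝ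

theorem neg_mem_rootsAt {p α : V} (hα : α ∈ A.rootsAt p) : -α ∈ A.rootsAt p := by
  rw [mem_rootsAt] at hα ⊢
  exact ⟨A.neg_mem α hα.1, by simp [hα.2]⟩

theorem InClosure.neg {p u x α : V} (h : A.InClosure p u x) (hα : α ∈ A.rootsAt p)
    (hu : ⟪α, u⟫_ℝ < 0) : ⟪α, x⟫_ℝ ≤ 0 := by
  simpa using h (-α) (neg_mem_rootsAt hα) (by simpa using hu)

theorem Refines.star_iff_inClosure {p x q u : V} (hq : A.Refines p x q) (hu : A.Star p u) :
    A.Star q u ↔ A.InClosure p u x := by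
  rw [hq.star_iff]
  constructor
  · intro h α hα hpos
    by_contra! hx
    have := h.2 (-α) (A.neg_mem α (mem_rootsAt.1 hα).1) (by simp [(mem_rootsAt.1 hα).2])
      (by simpa using hx)
    rw [inner_neg_left] at this
    linarith
  · intro h
    refine ⟨hu, fun α hα h0 hx => ?_⟩
    by_contra h1
    have := h.neg (mem_rootsAt.2 ⟨hα, h0⟩) ((hu.1.neg_iff hα).2 h1)
    linarith

theorem InClosure.eventually {p u x y : V} (h : A.InClosure p u x)
    (hy : ∀ α ∈ A.rootsAt p, ⟪α, x⟫_ℝ = 0 → 0 < ⟪α, u⟫_ℝ → 0 ≤ ⟪α, y⟫_ℝ) :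
    ∀ᶠ t : ℝ in 𝓝[>] 0, A.InClosure p u (x + t • y) := by
  filter_upwards [A.eventually_refines x y] with t ht α hα hu
  by_contra! hlt
  rcases (ht.neg (mem_rootsAt.1 hα).1).1 hlt with h1 | ⟨h1, h2⟩
  · exact absurd (h α hα hu) (not_le.2 h1)
  · exact absurd (hy α hα h1 hu) (not_le.2 h2)

theorem isClosed_inClosure (p : V) (P : V → Prop) :
    IsClosed {x | ∃ u, P u ∧ A.InClosure p u x} := by
  classical
  have : {x | ∃ u, P u ∧ A.InClosure p u x} =
      ⋃ S ∈ {S ∈ ((A.rootsAt p).powerset : Set (Finset V)) |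
        ∃ u, P u ∧ S = (A.rootsAt p).filter fun α => 0 < ⟪α, u⟫_ℝ},
        {x | ∀ α ∈ S, 0 ≤ ⟪α, x⟫_ℝ} := by
    ext x
    simp only [Set.mem_ofPred_eq, Set.mem_iUnion, exists_prop]
    constructor
    · rintro ⟨u, hu, h⟩
      exact ⟨(A.rootsAt p).filter fun α => 0 < ⟪α, u⟫_ℝ,
        ⟨Finset.mem_coe.2 (Finset.mem_powerset.2 (Finset.filter_subset _ _)), u, hu, rfl⟩,
        fun α hα => h α (Finset.mem_filter.1 hα).1
        (Finset.mem_filter.1 hα).2⟩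
    · rintro ⟨S, ⟨-, u, hu, rfl⟩, h⟩
      exact ⟨u, hu, fun α hα hpos => h α (Finset.mem_filter.2 ⟨hα, hpos⟩)⟩
  rw [this]
  refine Set.Finite.isClosed_biUnion ((Finset.finite_toSet _).subset (Set.sep_subset _ _))
    fun S _ => ?_
  simp only [Set.ofPred_forall]
  exact isClosed_biInter fun α _ => isClosed_le continuous_const (by fun_prop)

theorem InClosure.smul {p u x : V} (h : A.InClosure p u x) {c : ℝ} (hc : 0 ≤ c) :
    A.InClosure p u (c • x) := fun α hα hu => by
  rw [inner_smul_right]; exact mul_nonneg hc (h α hα hu)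

open Classical in
/-- Maximize `⟪x, T x⟫ / ⟪x, x⟫` over the closures of the chambers satisfying `P`, and choose the
maximizer to lie on as few hyperplanes as possible. -/
theorem exists_maximizer [FiniteDimensional ℝ V] {p : V} {P : V → Prop}
    (hne : ∃ x u, x ∈ A.rootSpan p ∧ x ≠ 0 ∧ P u ∧ A.InClosure p u x) :
    ∃ x u m, x ∈ A.rootSpan p ∧ x ≠ 0 ∧ P u ∧ A.InClosure p u x ∧
      ⟪x, A.T x⟫_ℝ = m * ⟪x, x⟫_ℝ ∧
      (∀ y u, y ∈ A.rootSpan p → P u → A.InClosure p u y → ⟪y, A.T y⟫_ℝ ≤ m * ⟪y, y⟫_ℝ) ∧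
      (∀ y u, y ∈ A.rootSpan p → y ≠ 0 → P u → A.InClosure p u y →
        ⟪y, A.T y⟫_ℝ = m * ⟪y, y⟫_ℝ →
        ((A.rootsAt p).filter fun α => ⟪α, x⟫_ℝ = 0).card ≤
          ((A.rootsAt p).filter fun α => ⟪α, y⟫_ℝ = 0).card) := by
  let X : Set V := Metric.sphere 0 1 ∩ ((A.rootSpan p : Set V) ∩
    {x | ∃ u, P u ∧ A.InClosure p u x})
  have hX : IsCompact X := (isCompact_sphere 0 1).inter_right
    ((Submodule.closed_of_finiteDimensional _).inter (isClosed_inClosure p P))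
  have hnorm : ∀ x u, x ∈ A.rootSpan p → x ≠ 0 → P u → A.InClosure p u x →
      ‖x‖⁻¹ • x ∈ X := fun x u h1 h2 h3 h4 =>
    ⟨by simp [norm_smul, h2], Submodule.smul_mem _ _ h1, u, h3, h4.smul (by positivity)⟩
  obtain ⟨x0, u0, h1, h2, h3, h4⟩ := hne
  have hTc : Continuous A.T := LinearMap.continuous_of_finiteDimensional _
  obtain ⟨x, hxX, hmax⟩ := hX.exists_isMaxOn ⟨_, hnorm x0 u0 h1 h2 h3 h4⟩
    (f := fun x => ⟪x, A.T x⟫_ℝ) (by fun_prop)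
  set m := ⟪x, A.T x⟫_ℝ with hm
  have hle : ∀ y u, y ∈ A.rootSpan p → P u → A.InClosure p u y →
      ⟪y, A.T y⟫_ℝ ≤ m * ⟪y, y⟫_ℝ := by
    intro y u hy hu hcl
    rcases eq_or_ne y 0 with rfl | hy0
    · simp
    have h5 : ⟪‖y‖⁻¹ • y, A.T (‖y‖⁻¹ • y)⟫_ℝ ≤ m := hmax (hnorm y u hy hy0 hu hcl)
    have h6 := norm_pos_iff.2 hy0
    simp only [map_smul, inner_smul_left, inner_smul_right, conj_trivial] at h5
    rw [real_inner_self_eq_norm_sq]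
    field_simp at h5
    linarith
  have hxs := mem_sphere_zero_iff_norm.1 hxX.1
  obtain ⟨-, hx2, u, hu, hcl⟩ := hxX
  have hex : ∃ n, ∃ y u, y ∈ A.rootSpan p ∧ y ≠ 0 ∧ P u ∧ A.InClosure p u y ∧
      ⟪y, A.T y⟫_ℝ = m * ⟪y, y⟫_ℝ ∧
      ((A.rootsAt p).filter fun α => ⟪α, y⟫_ℝ = 0).card = n :=
    ⟨_, x, u, hx2, by rintro rfl; simp at hxs, hu, hcl,
      by rw [real_inner_self_eq_norm_sq, hxs]; simp [hm], rfl⟩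
  obtain ⟨y, u, h5, h6, h7, h8, h9, h10⟩ := Nat.find_spec hex
  refine ⟨y, u, m, h5, h6, h7, h8, h9, hle, fun z u' g1 g2 g3 g4 g5 => ?_⟩
  rw [h10]
  exact Nat.find_min' hex ⟨z, u', g1, g2, g3, g4, g5, rfl⟩

end RootArrangement

end

section
open scoped InnerProductSpace
open Filter Topology
namespace RootArrangement
variable {V : Type*} [NormedAddCommGroup V] [InnerProductSpace ℝ V] {A : RootArrangement V}

theorem eventually_add_smul_ne_zero {x : V} (hx : x ≠ 0) (y : V) :
    ∀ᶠ t : ℝ in 𝓝[>] 0, x + t • y ≠ 0 := by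
  have hc : Tendsto (fun t : ℝ => x + t • y) (𝓝[>] 0) (𝓝 x) := by
    have : Continuous fun t : ℝ => x + t • y := by fun_prop
    simpa using (this.tendsto 0).mono_left nhdsWithin_le_nhds
  exact hc.eventually (isOpen_ne.mem_nhds hx)

/-- The orthogonal projection to the span of the roots at `p`. -/
theorem exists_mem_rootSpan_inner_eq [FiniteDimensional ℝ V] (p v : V) :
    ∃ a ∈ A.rootSpan p, ∀ y ∈ A.rootSpan p, ⟪y, a⟫_ℝ = ⟪y, v⟫_ℝ :=
  ⟨_, ((A.rootSpan p).orthogonalProjectionOnto v).2, fun y hy =>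
    (A.rootSpan p).inner_orthogonalProjectionOnto_eq_of_mem_left ⟨y, hy⟩ v⟩

/-- Among the chambers strongly conjugate to one of minimal displacement there is one whose closure
contains a generic eigenvector of `g + g⁻¹` for its largest eigenvalue. -/
theorem exists_rel_inClosure_eig [FiniteDimensional ℝ V] {p v : V} {l : ℝ} (hs : A.Stable p)
    (hl : ∀ x ∈ A.rootSpan p, ⟪x, A.T x⟫_ℝ ≤ l * ⟪x, x⟫_ℝ)
    (hne : ∃ x ∈ A.eig p l, x ≠ 0) (hv : A.IsMin p v) :
    ∃ u k, A.Rel p v u ∧ k ∈ A.eig p l ∧ k ≠ 0 ∧ A.InClosure p u k ∧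
      ∀ α ∈ A.rootsAt p, ⟪α, k⟫_ℝ = 0 → ∀ x ∈ A.eig p l, ⟪α, x⟫_ℝ = 0 := by
  classical
  induction hn : (A.rootsAt p).card using Nat.strong_induction_on generalizing p v with
  | _ n ih =>
  subst hn
  -- the projection of `v` to the span of the roots at `p`
  have hstart : ∃ x u, x ∈ A.rootSpan p ∧ x ≠ 0 ∧ A.Rel p v u ∧ A.InClosure p u x := by
    obtain ⟨k, hk, hk0⟩ := hne
    obtain ⟨α, hα, -⟩ := exists_inner_ne_zero (mem_eig.1 hk).1 hk0
    obtain ⟨a, ha, hproj⟩ := exists_mem_rootSpan_inner_eq (A := A) p v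
    refine ⟨a, v, ha, ?_, .refl, ?_⟩
    · rintro rfl
      have := hproj α (Submodule.subset_span hα)
      rw [inner_zero_right] at this
      exact hv.1.1 α (mem_rootsAt.1 hα).1 this.symm
    · intro β hβ h
      rw [hproj β (Submodule.subset_span hβ)]; exact h.le
  obtain ⟨x, u, m, hxU, hx0, hu, hcl, hxm, hmax, hmin⟩ := exists_maximizer hstart
  have hup := hv.rel hu
  have hml : m ≤ l := by
    have := hl x hxU
    rw [hxm] at this
    exact le_of_mul_le_mul_right this (real_inner_self_pos.2 hx0)
  have hfirst : ∀ y ∈ A.rootSpan p, ∀ w, A.Rel p v w → A.InClosure p w x →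
      (∀ α ∈ A.rootsAt p, ⟪α, x⟫_ℝ = 0 → 0 < ⟪α, w⟫_ℝ → 0 ≤ ⟪α, y⟫_ℝ) →
      ∀ᶠ t : ℝ in 𝓝[>] 0, A.InClosure p w (x + t • y) ∧
        ⟪x + t • y, A.T (x + t • y)⟫_ℝ ≤ m * ⟪x + t • y, x + t • y⟫_ℝ := by
    intro y hy w hw hwx hwy
    filter_upwards [hwx.eventually hwy] with t ht
    exact ⟨ht, hmax _ w (add_mem hxU (Submodule.smul_mem _ _ hy)) hw ht⟩
  have hminimal : ∀ y ∈ A.rootSpan p, ∀ w, A.Rel p v w → A.InClosure p w x →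
      (∀ α ∈ A.rootsAt p, ⟪α, x⟫_ℝ = 0 → 0 < ⟪α, w⟫_ℝ → 0 ≤ ⟪α, y⟫_ℝ) → A.T x = m • x →
      A.T y = m • y → ∀ α ∈ A.rootsAt p, ⟪α, x⟫_ℝ = 0 → ⟪α, y⟫_ℝ = 0 := by
    intro y hy w hw hwx hwy hTx hTy α hα hαx
    obtain ⟨t, ⟨ht1, ht2⟩, ht3, ht4⟩ := ((hfirst y hy w hw hwx hwy).and
      ((eventually_add_smul_ne_zero hx0 y).and (A.eventually_refines x y))).exists
    have hle := hmin (x + t • y) w (add_mem hxU (Submodule.smul_mem _ _ hy)) ht3 hw ht1 (by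
      rw [map_add, map_smul, hTx, hTy, smul_comm t m y, ← smul_add, inner_smul_right])
    have hsub : ((A.rootsAt p).filter fun α => ⟪α, x + t • y⟫_ℝ = 0) ⊆
        ((A.rootsAt p).filter fun α => ⟪α, x⟫_ℝ = 0) := fun β hβ => by
      rw [Finset.mem_filter] at hβ ⊢
      exact ⟨hβ.1, ((ht4.zero (mem_rootsAt.1 hβ.1).1).1 hβ.2).1⟩
    have hmem : α ∈ (A.rootsAt p).filter fun α => ⟪α, x + t • y⟫_ℝ = 0 := by
      rw [Finset.eq_of_subset_of_card_le hsub hle]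
      exact Finset.mem_filter.2 ⟨hα, hαx⟩
    exact ((ht4.zero (mem_rootsAt.1 hα).1).1 (Finset.mem_filter.1 hmem).2).2
  obtain ⟨q, hq⟩ := A.exists_refines p x
  have huq : A.Star q u := (hq.star_iff_inClosure hup.1).2 hcl
  have hmem_q : ∀ {α : V}, α ∈ A.rootsAt q ↔ α ∈ A.rootsAt p ∧ ⟪α, x⟫_ℝ = 0 := by
    intro α
    simp only [mem_rootsAt]
    constructor
    · rintro ⟨h1, h2⟩
      exact ⟨⟨h1, ((hq.zero h1).1 h2).1⟩, ((hq.zero h1).1 h2).2⟩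
    · rintro ⟨⟨h1, h2⟩, h3⟩
      exact ⟨h1, (hq.zero h1).2 ⟨h2, h3⟩⟩
  -- move into the direction of `g x`
  obtain ⟨q2, hq2⟩ := A.exists_refines q (A.g x)
  obtain ⟨w, hw, hwc⟩ := exists_cyc_star hq2 (fun a β ha hβ hβq _ hy => by
    left
    rw [inner_map_right] at hy ⊢
    have hβp := hs.symm ((hmem_q.1 (mem_rootsAt.2 ⟨hβ, hβq⟩)).1)
    have := mem_rootsAt.1 hβp
    exact ha.neg A this.1 ((hq.neg this.1).2 (Or.inr ⟨this.2, hy⟩))) huq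
  have hminq : A.IsMin q u := hup.mono huq hq.star_mono
  have hvw : A.Rel p v w := hu.trans ((hminq.rel_of_cyc hwc).mono hq.star_mono)
  have hwp := hv.rel hvw
  have hwq : A.Star q w := hq2.star_mono _ hw
  have hwx : A.InClosure p w x := (hq.star_iff_inClosure hwp.1).1 hwq
  have hwy : ∀ α ∈ A.rootsAt p, ⟪α, x⟫_ℝ = 0 → 0 < ⟪α, w⟫_ℝ → 0 ≤ ⟪α, A.g x⟫_ℝ :=
    fun α hα hαx => (hq2.star_iff_inClosure hwq).1 hw α (hmem_q.2 ⟨hα, hαx⟩)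
  have hTx : A.T x = m • x := by
    have h1 := inner_T_le_of_eventually hxm
      ((hfirst _ (hs.g_mem hxU) w hvw hwx hwy).mono fun t ht => ht.2)
    have h2 := inner_T_T (A := A) x
    have h3 := inner_self_T (A := A) x
    have h4 := real_inner_comm x (A.g x)
    have h5 : ⟪A.T x - m • x, A.T x - m • x⟫_ℝ ≤ 0 := by
      have h6 := real_inner_comm x (A.T x)
      have h7 : m * ⟪A.g x, x⟫_ℝ = m * ⟪x, A.T x⟫_ℝ / 2 := by rw [h3, h4]; ring
      simp only [inner_sub_left, inner_sub_right, inner_smul_left, inner_smul_right, conj_trivial]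
      rw [h6, ← hxm]
      linarith
    exact sub_eq_zero.1 (inner_self_eq_zero (𝕜 := ℝ).1 (le_antisymm h5 real_inner_self_nonneg))
  have hTgx : A.T (A.g x) = m • A.g x := by
    rw [← map_smul, ← hTx, T_apply, T_apply, map_add]; simp
  have hqs : A.Stable q := by
    refine stable_of_symm fun α hα => hmem_q.2 ⟨hs.symm (hmem_q.1 hα).1, ?_⟩
    rw [← inner_map_right]
    exact hminimal _ (hs.g_mem hxU) w hvw hwx hwy hTx hTgx α (hmem_q.1 hα).1 (hmem_q.1 hα).2
  have hsub : A.rootSpan q ≤ A.rootSpan p := Submodule.span_mono hq.rootsAt_subset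
  by_cases hK : ∀ α ∈ A.rootsAt q, ∀ k ∈ A.eig p l, ⟪α, k⟫_ℝ = 0
  · obtain ⟨k, hk, hk0⟩ := hne
    rw [mem_eig] at hk
    have hlm : l ≤ m := le_of_eventually hTx hk.2 hk0
      ((hfirst k hk.1 u hu hcl fun α hα hαx _ =>
        (hK α (hmem_q.2 ⟨hα, hαx⟩) k (mem_eig.2 hk)).ge).mono fun t ht => ht.2).frequently
    obtain rfl : m = l := le_antisymm hml hlm
    exact ⟨u, x, hu, mem_eig.2 ⟨hxU, hTx⟩, hx0, hcl,
      fun α hα hαx y hy => hK α (hmem_q.2 ⟨hα, hαx⟩) y hy⟩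
  · exfalso
    push Not at hK
    obtain ⟨α, hα, k, hk, hαk⟩ := hK
    rw [mem_eig] at hk
    have hneq : ∃ a ∈ A.eig q l, a ≠ 0 := by
      obtain ⟨a, haU, hb⟩ := exists_mem_rootSpan_inner_eq (A := A) q k
      refine ⟨a, mem_eig.2 ⟨haU, ?_⟩, fun h0 => hαk ?_⟩
      · have hc : A.T a - l • a ∈ A.rootSpan q :=
          sub_mem (hqs.T_mem haU) (Submodule.smul_mem _ _ haU)
        have : ⟪A.T a - l • a, A.T a - l • a⟫_ℝ = 0 := by
          set c := A.T a - l • a with hcdef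
          rw [hcdef, inner_sub_right, inner_T_comm, inner_smul_right, ← hcdef, hb _ hc,
            hb _ (hqs.T_mem hc), ← inner_T_comm, hk.2, inner_smul_right, sub_self]
        exact sub_eq_zero.1 (inner_self_eq_zero.1 this)
      · rw [← hb α (Submodule.subset_span hα), h0, inner_zero_right]
    obtain ⟨β, hβ, hβx⟩ := exists_inner_ne_zero hxU hx0
    obtain ⟨u2, k', hr, hk', hk'0, hcl', -⟩ := ih _ (hq.card_lt hβ hβx) hqs
      (fun y hy => hl y (hsub hy)) hneq hminq rfl
    rw [mem_eig] at hk'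
    have hvu2 : A.Rel p v u2 := hu.trans (hr.mono hq.star_mono)
    have hu2q := hr.star huq
    have hu2x : A.InClosure p u2 x := (hq.star_iff_inClosure (hv.rel hvu2).1).1 hu2q
    have hu2y : ∀ α ∈ A.rootsAt p, ⟪α, x⟫_ℝ = 0 → 0 < ⟪α, u2⟫_ℝ → 0 ≤ ⟪α, k'⟫_ℝ :=
      fun α hα hαx => hcl' α (hmem_q.2 ⟨hα, hαx⟩)
    have hlm : l ≤ m := le_of_eventually hTx hk'.2 hk'0
      ((hfirst k' (hsub hk'.1) u2 hvu2 hu2x hu2y).mono fun t ht => ht.2).frequently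
    obtain rfl : m = l := le_antisymm hml hlm
    obtain ⟨γ, hγ, hγk⟩ := exists_inner_ne_zero hk'.1 hk'0
    exact hγk (hminimal k' (hsub hk'.1) u2 hvu2 hu2x hu2y hTx hk'.2 γ (hmem_q.1 hγ).1
      (hmem_q.1 hγ).2)

end RootArrangement

end

section
open scoped InnerProductSpace
open Filter Topology
namespace RootArrangement
variable {V : Type*} [NormedAddCommGroup V] [InnerProductSpace ℝ V] {A : RootArrangement V}

theorem exists_max_eig [FiniteDimensional ℝ V] {p : V} (hs : A.Stable p)
    (hne : (A.rootsAt p).Nonempty) :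
    ∃ l, (∀ x ∈ A.rootSpan p, ⟪x, A.T x⟫_ℝ ≤ l * ⟪x, x⟫_ℝ) ∧ ∃ x ∈ A.eig p l, x ≠ 0 := by
  classical
  have hcl : ∀ x, A.InClosure p 0 x := fun x α _ h => by simp at h
  obtain ⟨α, hα⟩ := hne
  obtain ⟨x, u, m, hx, hx0, rfl, -, hxm, hmax, -⟩ := exists_maximizer (A := A) (p := p)
    (P := fun u => u = 0) ⟨α, 0, Submodule.subset_span hα,
      fun h => A.zero_notMem (h ▸ (mem_rootsAt.1 hα).1), rfl, hcl α⟩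
  refine ⟨m, fun y hy => hmax y 0 hy rfl (hcl y), x, mem_eig.2 ⟨hx, ?_⟩, hx0⟩
  have hy : A.T x - m • x ∈ A.rootSpan p := sub_mem (hs.T_mem hx) (Submodule.smul_mem _ _ hx)
  have h1 := inner_T_le_of_eventually (y := A.T x - m • x) hxm (Eventually.of_forall fun t =>
    hmax _ 0 (add_mem hx (Submodule.smul_mem _ _ hy)) rfl (hcl _))
  have h2 : ⟪A.T x - m • x, A.T x - m • x⟫_ℝ ≤ 0 := by
    rw [inner_sub_right _ (A.T x), inner_smul_right]; linarith
  exact sub_eq_zero.1 (inner_self_eq_zero (𝕜 := ℝ).1 (le_antisymm h2 real_inner_self_nonneg))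

/-- The argument after a rotation by `θ`, away from the branch cut. -/
theorem arg_mul_cos_add_sin {w : ℂ} {θ : ℝ} (h0 : 0 < θ) (hπ : θ < Real.pi) (hw : w.im ≠ 0) :
    (w * (Complex.cos θ + Complex.sin θ * Complex.I)).arg = w.arg + θ -
      if 0 < w.im ∧ (w * (Complex.cos θ + Complex.sin θ * Complex.I)).im < 0
        then 2 * Real.pi else 0 := by
  have hw0 : w ≠ 0 := by rintro rfl; simp at hw
  have hr : 0 < ‖w‖ := norm_pos_iff.2 hw0
  have hpolar : w * (Complex.cos θ + Complex.sin θ * Complex.I) =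
      (‖w‖ : ℂ) * (Complex.cos ((w.arg + θ : ℝ) : ℂ) +
        Complex.sin ((w.arg + θ : ℝ) : ℂ) * Complex.I) := by
    conv_lhs => rw [← Complex.norm_mul_cos_add_sin_mul_I w]
    push_cast
    rw [Complex.cos_add, Complex.sin_add]
    linear_combination (‖w‖ : ℂ) * Complex.sin w.arg * Complex.sin θ * Complex.I_sq
  have him : (w * (Complex.cos θ + Complex.sin θ * Complex.I)).im =
      ‖w‖ * Real.sin (w.arg + θ) := by
    rw [hpolar, ← Complex.ofReal_cos, ← Complex.ofReal_sin, Complex.im_ofReal_mul, Complex.add_im]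
    simp only [Complex.ofReal_im, Complex.mul_I_im, Complex.ofReal_re, zero_add]
  rw [him, hpolar]
  have h1 := Complex.neg_pi_lt_arg w
  have h2 : w.arg < Real.pi := by
    refine lt_of_le_of_ne (Complex.arg_le_pi w) fun h => hw ?_
    exact (Complex.arg_eq_pi_iff.1 h).2
  rcases lt_or_gt_of_ne hw with hneg | hpos
  · have h3 := Complex.arg_neg_iff.2 hneg
    rw [Complex.arg_mul_cos_add_sin_mul_I hr ⟨by linarith, by linarith⟩,
      if_neg fun h => by linarith [h.1], sub_zero]
  · have h3 : 0 < w.arg := by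
      refine lt_of_le_of_ne (Complex.arg_nonneg_iff.2 hpos.le) fun h => ?_
      have := (Complex.arg_eq_zero_iff.1 h.symm).2
      linarith
    by_cases h4 : w.arg + θ ≤ Real.pi
    · have := mul_nonneg hr.le (Real.sin_nonneg_of_nonneg_of_le_pi (by linarith) h4)
      rw [Complex.arg_mul_cos_add_sin_mul_I hr ⟨by linarith, h4⟩,
        if_neg fun h => by linarith [h.2], sub_zero]
    · push Not at h4
      have hsin : Real.sin (w.arg + θ) < 0 := by
        have := Real.sin_pos_of_pos_of_lt_pi (x := w.arg + θ - Real.pi) (by linarith)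
          (by linarith)
        rw [Real.sin_sub_pi] at this
        linarith
      rw [if_pos ⟨hpos, mul_neg_of_pos_of_neg hr hsin⟩]
      have := Complex.arg_mul_cos_add_sin_mul_I hr (θ := w.arg + θ - 2 * Real.pi)
        ⟨by linarith, by linarith⟩
      rw [← Complex.ofReal_cos, ← Complex.ofReal_sin, Real.cos_sub_two_pi, Real.sin_sub_two_pi]
        at this
      rw [← Complex.ofReal_cos, ← Complex.ofReal_sin, this]

open Classical in
/-- The number of roots separating a generic eigenvector `k` from `g k` depends only on the
eigenvalue. -/
theorem card_sep_eig {Ψ : Finset V} (hΨ : ∀ α ∈ Ψ, A.g.symm α ∈ Ψ) {k : V} {θ : ℝ} (h0 : 0 < θ)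
    (hπ : θ < Real.pi) (hk : A.T k = (2 * Real.cos θ) • k) (hreg : ∀ α ∈ Ψ, ⟪α, k⟫_ℝ ≠ 0) :
    ((Ψ.filter fun α => 0 < ⟪α, k⟫_ℝ ∧ ⟪α, A.g k⟫_ℝ < 0).card : ℝ) * (2 * Real.pi) =
      Ψ.card * θ := by
  have hsin : Real.sin θ ≠ 0 := (Real.sin_pos_of_pos_of_lt_pi h0 hπ).ne'
  let w : V → ℂ := fun α => ⟨(⟪α, A.g k⟫_ℝ - Real.cos θ * ⟪α, k⟫_ℝ) / Real.sin θ, ⟪α, k⟫_ℝ⟩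
  have hrec : ∀ α, ⟪A.g.symm α, A.g k⟫_ℝ = 2 * Real.cos θ * ⟪α, A.g k⟫_ℝ - ⟪α, k⟫_ℝ := by
    intro α
    have h1 : A.T (A.g k) = (2 * Real.cos θ) • A.g k := by
      rw [← map_smul, ← hk, T_apply, T_apply, map_add]; simp
    have h2 := congrArg (fun y => ⟪α, y⟫_ℝ) h1
    simp only [T_apply, inner_add_right, inner_smul_right, LinearIsometryEquiv.symm_apply_apply]
      at h2
    rw [← inner_map_right]
    linarith
  have hw : ∀ α, w (A.g.symm α) = w α * (Complex.cos θ + Complex.sin θ * Complex.I) := by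
    intro α
    have hsc := Real.sin_sq_add_cos_sq θ
    rw [← Complex.ofReal_cos, ← Complex.ofReal_sin]
    apply Complex.ext
    · simp only [w, hrec, ← inner_map_right, Complex.mul_re, Complex.add_re, Complex.ofReal_re,
        Complex.ofReal_im, Complex.I_re, Complex.I_im, Complex.add_im, Complex.mul_im]
      field_simp
      linear_combination ⟪α, k⟫_ℝ * hsc
    · simp only [w, ← inner_map_right, Complex.mul_re, Complex.add_re, Complex.ofReal_re,
        Complex.ofReal_im, Complex.I_re, Complex.I_im, Complex.add_im, Complex.mul_im]
      field_simp
      ring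
  have himage : Ψ.image A.g.symm = Ψ :=
    Finset.eq_of_subset_of_card_le (Finset.image_subset_iff.2 hΨ)
      (Finset.card_image_of_injective _ A.g.symm.injective).ge
  have hsum : ∑ α ∈ Ψ, (w (A.g.symm α)).arg = ∑ α ∈ Ψ, (w α).arg := by
    conv_rhs => rw [← himage]
    rw [Finset.sum_image A.g.symm.injective.injOn]
  have hstep : ∀ α ∈ Ψ, (w (A.g.symm α)).arg = (w α).arg + θ -
      if 0 < ⟪α, k⟫_ℝ ∧ ⟪α, A.g k⟫_ℝ < 0 then 2 * Real.pi else 0 := by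
    intro α hα
    have h1 := arg_mul_cos_add_sin h0 hπ (w := w α) (hreg α hα)
    rw [← hw] at h1
    have h2 : (w (A.g.symm α)).im = ⟪α, A.g k⟫_ℝ := by simp only [w, ← inner_map_right]
    rwa [h2] at h1
  rw [Finset.sum_congr rfl hstep, Finset.sum_sub_distrib, Finset.sum_add_distrib, Finset.sum_const,
    ← Finset.sum_filter, Finset.sum_const] at hsum
  simp only [nsmul_eq_mul] at hsum
  linarith

end RootArrangement

end

section
open scoped InnerProductSpace
open Filter Topology
namespace RootArrangement
variable {V : Type*} [NormedAddCommGroup V] [InnerProductSpace ℝ V] {A : RootArrangement V}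

theorem T_g (x : V) : A.T (A.g x) = A.g (A.T x) := by simp [T_apply]

theorem g_mem_eig {p x : V} {l : ℝ} (hs : A.Stable p) (hx : x ∈ A.eig p l) :
    A.g x ∈ A.eig p l := by
  rw [mem_eig] at hx ⊢
  exact ⟨hs.g_mem hx.1, by rw [T_g, hx.2, map_smul]⟩

theorem symm_mem_eig {p x : V} {l : ℝ} (hs : A.Stable p) (hx : x ∈ A.eig p l) :
    A.g.symm x ∈ A.eig p l := by
  rw [mem_eig] at hx ⊢
  refine ⟨hs.symm_mem hx.1, A.g.injective ?_⟩
  rw [← T_g, map_smul, LinearIsometryEquiv.apply_symm_apply, hx.2]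

theorem InClosure.pos_iff {p u k : V} (h : A.InClosure p u k) (hu : A.Regular u) {α : V}
    (hα : α ∈ A.rootsAt p) (hk : ⟪α, k⟫_ℝ ≠ 0) : 0 < ⟪α, u⟫_ℝ ↔ 0 < ⟪α, k⟫_ℝ := by
  refine ⟨fun h1 => lt_of_le_of_ne (h α hα h1) hk.symm, fun h1 => ?_⟩
  by_contra h2
  have := h.neg hα ((hu.neg_iff (mem_rootsAt.1 hα).1).2 h2)
  linarith

/-- Chambers whose closures contain generic eigenvectors for the same nonreal eigenvalues, and which
agree on the roots orthogonal to these, have the same displacement. -/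
theorem len_eq_of_generic {p : V} {θ : ℝ} (hs : A.Stable p) (h0 : 0 < θ) (hπ : θ < Real.pi)
    {u u' k k' : V} (hu : A.Star p u) (hu' : A.Star p u')
    (hk : k ∈ A.eig p (2 * Real.cos θ)) (hk' : k' ∈ A.eig p (2 * Real.cos θ))
    (hgen : ∀ α ∈ A.rootsAt p, ⟪α, k⟫_ℝ = 0 → ∀ x ∈ A.eig p (2 * Real.cos θ), ⟪α, x⟫_ℝ = 0)
    (hgen' : ∀ α ∈ A.rootsAt p, ⟪α, k'⟫_ℝ = 0 → ∀ x ∈ A.eig p (2 * Real.cos θ), ⟪α, x⟫_ℝ = 0)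
    (hcl : A.InClosure p u k) (hcl' : A.InClosure p u' k')
    (hsame : ∀ α ∈ A.rootsAt p, (∀ x ∈ A.eig p (2 * Real.cos θ), ⟪α, x⟫_ℝ = 0) →
      (0 < ⟪α, u⟫_ℝ ↔ 0 < ⟪α, u'⟫_ℝ)) : A.len u = A.len u' := by
  classical
  set l := 2 * Real.cos θ with hl
  set Ψ := (A.rootsAt p).filter fun α => ∃ x ∈ A.eig p l, ⟪α, x⟫_ℝ ≠ 0 with hΨdef
  have hΨ : ∀ α ∈ Ψ, A.g.symm α ∈ Ψ := by
    intro α hα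
    rw [hΨdef, Finset.mem_filter] at hα ⊢
    obtain ⟨h1, x, hx, hxα⟩ := hα
    exact ⟨hs.symm h1, A.g.symm x, symm_mem_eig hs hx, by simpa using hxα⟩
  have hfirst : ∀ {u k : V}, A.Star p u → k ∈ A.eig p l →
      (∀ α ∈ A.rootsAt p, ⟪α, k⟫_ℝ = 0 → ∀ x ∈ A.eig p l, ⟪α, x⟫_ℝ = 0) → A.InClosure p u k →
      (((A.sep u (A.g u)).filter fun α => α ∈ Ψ).card : ℝ) * (2 * Real.pi) = Ψ.card * θ := by
    intro u k hu hk hgen hcl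
    have hreg : ∀ α ∈ Ψ, ⟪α, k⟫_ℝ ≠ 0 := by
      intro α hα h
      obtain ⟨h1, x, hx, hxα⟩ := Finset.mem_filter.1 hα
      exact hxα (hgen α h1 h x hx)
    rw [← card_sep_eig hΨ h0 hπ (mem_eig.1 hk).2 hreg]
    congr 3
    ext α
    simp only [Finset.mem_filter, mem_sep]
    have hsub : ∀ β ∈ Ψ, β ∈ A.rootsAt p := fun β hβ => (Finset.mem_filter.1 hβ).1
    have hgΨ : α ∈ Ψ → (⟪α, A.g u⟫_ℝ < 0 ↔ ⟪α, A.g k⟫_ℝ < 0) := by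
      intro hα
      have h3 := hreg _ (hΨ α hα)
      have h1 := hcl.pos_iff hu.1 (hsub _ (hΨ α hα)) h3
      rw [inner_map_right, inner_map_right,
        hu.1.neg_iff (A.symm_mem (mem_rootsAt.1 (hsub α hα)).1), h1]
      grind
    constructor
    · rintro ⟨⟨h1, h2, h3⟩, h4⟩
      exact ⟨h4, (hcl.pos_iff hu.1 (hsub α h4) (hreg α h4)).1 h2, (hgΨ h4).1 h3⟩
    · rintro ⟨h4, h2, h3⟩
      exact ⟨⟨(mem_rootsAt.1 (hsub α h4)).1, (hcl.pos_iff hu.1 (hsub α h4) (hreg α h4)).2 h2,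
        (hgΨ h4).2 h3⟩, h4⟩
  have hrest : (A.sep u (A.g u)).filter (fun α => α ∉ Ψ) =
      (A.sep u' (A.g u')).filter fun α => α ∉ Ψ := by
    ext α
    simp only [Finset.mem_filter, mem_sep]
    by_cases hα : α ∈ A.roots
    swap
    · simp [hα]
    rw [hu.1.map.neg_iff hα, hu'.1.map.neg_iff hα]
    by_cases hαp : ⟪α, p⟫_ℝ = 0
    swap
    · rw [hu.pos_iff hα hαp, hu'.pos_iff hα hαp, hu.map_pos_iff hs hα hαp,
        hu'.map_pos_iff hs hα hαp]
    have hα' := mem_rootsAt.2 ⟨hα, hαp⟩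
    by_cases hαΨ : α ∈ Ψ
    · simp [hαΨ]
    have horth : ∀ x ∈ A.eig p l, ⟪α, x⟫_ℝ = 0 := by
      intro x hx
      by_contra h
      exact hαΨ (Finset.mem_filter.2 ⟨hα', x, hx, h⟩)
    rw [hsame α hα' horth, inner_map_right, inner_map_right, hsame _ (hs.symm hα') fun x hx => by
      rw [← inner_map_right]; exact horth _ (g_mem_eig hs hx)]
  have h1 := hfirst hu hk hgen hcl
  have h2 := hfirst hu' hk' hgen' hcl'
  have h3 : ((A.sep u (A.g u)).filter fun α => α ∈ Ψ).card =
      ((A.sep u' (A.g u')).filter fun α => α ∈ Ψ).card := by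
    have := mul_right_cancel₀ (by positivity) (h1.trans h2.symm)
    exact_mod_cast this
  rw [len, len, d, d, ← Finset.card_filter_add_card_filter_not (s := A.sep u (A.g u)) (· ∈ Ψ),
    ← Finset.card_filter_add_card_filter_not (s := A.sep u' (A.g u')) (· ∈ Ψ), h3, hrest]

/-- For nonreal eigenvalues, every eigenvector lies in the closure of a chamber of minimal
displacement. -/
theorem exists_isMin_inClosure [FiniteDimensional ℝ V] {p v : V} {θ : ℝ} (hs : A.Stable p)
    (h0 : 0 < θ) (hπ : θ < Real.pi)
    (hl : ∀ x ∈ A.rootSpan p, ⟪x, A.T x⟫_ℝ ≤ 2 * Real.cos θ * ⟪x, x⟫_ℝ)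
    (hne : ∃ x ∈ A.eig p (2 * Real.cos θ), x ≠ 0) (hv : A.IsMin p v) {k : V}
    (hk : k ∈ A.eig p (2 * Real.cos θ)) : ∃ u, A.IsMin p u ∧ A.InClosure p u k := by
  obtain ⟨v1, k1, hr, hk1, -, hcl, hgen⟩ := exists_rel_inClosure_eig hs hl hne hv
  have hv1 := hv.rel hr
  obtain ⟨t, ht⟩ := (A.eventually_refines k k1).exists
  set k3 := k + t • k1 with hk3def
  have hk3 : k3 ∈ A.eig p (2 * Real.cos θ) := add_mem hk (Submodule.smul_mem _ _ hk1)
  have hgen3 : ∀ α ∈ A.rootsAt p, ⟪α, k3⟫_ℝ = 0 →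
      ∀ x ∈ A.eig p (2 * Real.cos θ), ⟪α, x⟫_ℝ = 0 := fun α hα h =>
    hgen α hα ((ht.zero (mem_rootsAt.1 hα).1).1 h).2
  obtain ⟨q, hq⟩ := A.exists_refines p k3
  obtain ⟨u, hu⟩ := A.exists_refines q v1
  have huq : A.Star q u := hu.star hv1.1.1
  have hup := hq.star_mono u huq
  have hcl3 := (hq.star_iff_inClosure hup).1 huq
  refine ⟨u, ⟨hup, fun w hw => ?_⟩, fun α hα h => ?_⟩
  · refine le_of_eq_of_le ?_ (hv1.2 w hw)
    refine len_eq_of_generic hs h0 hπ hup hv1.1 hk3 hk1 hgen3 hgen hcl3 hcl fun α hα h => ?_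
    have hα' := mem_rootsAt.1 hα
    rw [hu α hα'.1, (hq.zero hα'.1).2 ⟨hα'.2, h k3 hk3⟩]
    simp
  · by_contra! hlt
    have := (ht.neg (mem_rootsAt.1 hα).1).2 (Or.inl hlt)
    linarith [hcl3 α hα h]

theorem isPreconnected_sphere_eig {p : V} {l : ℝ} (hs : A.Stable p) (h2 : l ≠ 2) (h2' : l ≠ -2)
    (hne : ∃ x ∈ A.eig p l, x ≠ 0) :
    IsPreconnected (Metric.sphere (0 : A.eig p l) 1) := by
  refine isPreconnected_sphere ?_ 0 1
  by_contra! h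
  obtain ⟨x0, hx0⟩ := rank_le_one_iff.1 h
  obtain ⟨x, hx, hxne⟩ := hne
  obtain ⟨a, ha⟩ := hx0 ⟨x, hx⟩
  obtain ⟨b, hb⟩ := hx0 ⟨_, g_mem_eig hs hx⟩
  have ha' : a • (x0 : V) = x := congrArg Subtype.val ha
  have hb' : b • (x0 : V) = A.g x := congrArg Subtype.val hb
  have ha0 : a ≠ 0 := by
    rintro rfl
    simp at ha'
    exact hxne ha'.symm
  have hg : A.g x = (b / a) • x := by
    rw [← hb', ← ha', smul_smul, div_mul_cancel₀ _ ha0]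
  set c := b / a
  have hn : ‖x‖ = |c| * ‖x‖ := by
    rw [← Real.norm_eq_abs, ← norm_smul, ← hg, LinearIsometryEquiv.norm_map]
  have hc : |c| = 1 := by
    have := norm_pos_iff.2 hxne
    exact (mul_right_cancel₀ this.ne' (by rw [one_mul, ← hn])).symm
  have hl : l = 2 * c := by
    have h3 := inner_self_T (A := A) x
    rw [(mem_eig.1 hx).2, hg, inner_smul_right, inner_smul_right, ← mul_assoc] at h3
    exact mul_right_cancel₀ (real_inner_self_pos.2 hxne).ne' h3
  rcases abs_eq (by norm_num : (0 : ℝ) ≤ 1) |>.1 hc with h | h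
  · exact h2 (by rw [hl, h]; norm_num)
  · exact h2' (by rw [hl, h]; norm_num)

theorem rel_of_sep_rootsAt {p v v' : V} (hv : A.IsMin p v) (hv' : A.IsMin p v')
    (h : ∀ α ∈ A.rootsAt p, 0 < ⟪α, v⟫_ℝ → ¬ ⟪α, v'⟫_ℝ < 0) : A.Rel p v v' := by
  refine .single ⟨hv.1, hv'.1, le_antisymm (hv.2 _ hv'.1) (hv'.2 _ hv.1), Or.inl ?_⟩
  refine le_of_eq_of_le (Finset.card_eq_zero.2 ?_) zero_le_one
  rw [Finset.eq_empty_iff_forall_notMem]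
  intro α hα
  rw [mem_sep] at hα
  by_cases hp : ⟪α, p⟫_ℝ = 0
  · exact h α (mem_rootsAt.2 ⟨hα.1, hp⟩) hα.2.1 hα.2.2
  · have h1 := (hv.1.pos_iff hα.1 hp).1 hα.2.1
    linarith [hv'.1.2 α hα.1 h1, hα.2.2]

/-- Chambers of minimal displacement in the star of `p` are strongly conjugate. -/
theorem rel_of_isMin [FiniteDimensional ℝ V] {p v v' : V} (hv : A.IsMin p v)
    (hv' : A.IsMin p v') : A.Rel p v v' := by
  induction hn : (A.rootsAt p).card using Nat.strong_induction_on generalizing p v v' with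
  | _ n ih =>
  subst hn
  by_cases hs : A.Stable p
  swap
  · obtain ⟨q, hq⟩ := A.exists_refines p (A.g p)
    have hdesc : ∀ {v}, A.IsMin p v → ∃ v1, A.Rel p v v1 ∧ A.IsMin q v1 := by
      intro v hv
      obtain ⟨v1, hv1, hc⟩ := exists_cyc_star hq (fun u β hu hβ _ _ hy => by
        left
        rw [inner_map_right] at hy ⊢
        exact hu.neg A (A.symm_mem hβ) hy) hv.1
      have hr := hv.rel_of_cyc hc
      exact ⟨v1, hr, (hv.rel hr).mono hv1 hq.star_mono⟩
    obtain ⟨v1, hr, h1⟩ := hdesc hv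
    obtain ⟨v1', hr', h1'⟩ := hdesc hv'
    have hlt : (A.rootsAt q).card < (A.rootsAt p).card := by
      have : ∃ α ∈ A.rootsAt p, A.g.symm α ∉ A.rootsAt p := by
        by_contra! h
        exact hs (stable_of_symm h)
      obtain ⟨α, hα, h⟩ := this
      refine hq.card_lt hα fun h0 => h (mem_rootsAt.2 ⟨A.symm_mem (mem_rootsAt.1 hα).1, ?_⟩)
      rwa [inner_map_right] at h0
    exact (hr.trans ((ih _ hlt h1 h1' rfl).mono hq.star_mono)).trans hr'.symm
  rcases (A.rootsAt p).eq_empty_or_nonempty with hemp | hne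
  · exact rel_of_sep_rootsAt hv hv' fun α hα => by simp [hemp] at hα
  obtain ⟨l, hl, hneig⟩ := exists_max_eig hs hne
  have hlbd : -2 ≤ l ∧ l ≤ 2 := by
    obtain ⟨x, hx, hx0⟩ := hneig
    have h1 := inner_self_T (A := A) x
    rw [(mem_eig.1 hx).2, inner_smul_right] at h1
    have h2 := abs_le.1 (abs_real_inner_le_norm x (A.g x))
    rw [LinearIsometryEquiv.norm_map, ← real_inner_self_eq_norm_mul_norm] at h2
    have h3 := real_inner_self_pos.2 hx0
    constructor <;> nlinarith
  -- passing to the star of an eigenvector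
  have hpass : ∀ {k q w w' : V}, k ∈ A.rootSpan p → k ≠ 0 → A.Refines p k q → A.IsMin p w →
      A.IsMin p w' → A.Star q w → A.Star q w' → A.Rel p w w' := by
    intro k q w w' hk hk0 hq hw hw' hwq hwq'
    obtain ⟨α, hα, hαk⟩ := exists_inner_ne_zero hk hk0
    exact (ih _ (hq.card_lt hα hαk) (hw.mono hwq hq.star_mono) (hw'.mono hwq' hq.star_mono)
      rfl).mono hq.star_mono
  obtain ⟨v1, k1, hr1, hk1, hk10, hcl1, hgen1⟩ := exists_rel_inClosure_eig hs hl hneig hv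
  obtain ⟨v1', k2, hr2, hk2, hk20, hcl2, -⟩ := exists_rel_inClosure_eig hs hl hneig hv'
  have hv1 := hv.rel hr1
  have hv1' := hv'.rel hr2
  by_cases hl2 : l = 2
  · -- `g` fixes the eigenvectors
    subst hl2
    have hfix : ∀ k ∈ A.eig p 2, A.g k = k := by
      intro k hk
      have h1 := inner_self_T (A := A) k
      rw [(mem_eig.1 hk).2, inner_smul_right] at h1
      have h2 : ⟪A.g k - k, A.g k - k⟫_ℝ = 0 := by
        have h3 := real_inner_comm k (A.g k)
        rw [inner_sub_left, inner_sub_right, inner_sub_right, LinearIsometryEquiv.inner_map_map]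
        linarith
      exact sub_eq_zero.1 (inner_self_eq_zero (𝕜 := ℝ).1 h2)
    obtain ⟨q, hq⟩ := A.exists_refines p k2
    obtain ⟨v2, hv2⟩ := A.exists_refines q v1
    have hv2q : A.Star q v2 := hv2.star hv1.1.1
    have hv2p := hq.star_mono _ hv2q
    have hcl2' := (hq.star_iff_inClosure hv2p).1 hv2q
    -- `v2` looks like `v1` on the roots orthogonal to `k2`
    have hsame : ∀ α ∈ A.rootsAt p, ⟪α, k2⟫_ℝ = 0 → (0 < ⟪α, v2⟫_ℝ ↔ 0 < ⟪α, v1⟫_ℝ) := by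
      intro α hα h
      have hα' := mem_rootsAt.1 hα
      rw [hv2 α hα'.1, (hq.zero hα'.1).2 ⟨hα'.2, h⟩]
      simp
    have hgsame : ∀ {w k : V}, A.Star p w → A.InClosure p w k → k ∈ A.eig p 2 →
        ∀ α ∈ A.rootsAt p, ⟪α, k⟫_ℝ ≠ 0 → (0 < ⟪α, A.g w⟫_ℝ ↔ 0 < ⟪α, w⟫_ℝ) := by
      intro w k hw hcl hk α hα hαk
      have h1 : ⟪A.g.symm α, k⟫_ℝ = ⟪α, k⟫_ℝ := by rw [← inner_map_right, hfix k hk]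
      rw [inner_map_right, hcl.pos_iff hw.1 (hs.symm hα) (by rwa [h1]), h1,
        hcl.pos_iff hw.1 hα hαk]
    have hlen : A.len v2 = A.len v1 := by
      refine le_antisymm (Finset.card_le_card fun α hα => ?_) (hv1.2 _ hv2p)
      rw [mem_sep] at hα ⊢
      rw [hv2p.1.map.neg_iff hα.1] at hα
      rw [hv1.1.1.map.neg_iff hα.1]
      by_cases hp : ⟪α, p⟫_ℝ = 0
      · have hαp := mem_rootsAt.2 ⟨hα.1, hp⟩
        have hαk : ⟪α, k2⟫_ℝ = 0 := by
          by_contra h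
          have := hgsame hv2p hcl2' hk2 α hαp h
          tauto
        rw [hsame α hαp hαk, inner_map_right, hsame _ (hs.symm hαp) (by
          rw [← inner_map_right, hfix k2 hk2, hαk]), ← inner_map_right] at hα
        exact hα
      · rw [hv2p.pos_iff hα.1 hp, hv2p.map_pos_iff hs hα.1 hp] at hα
        rwa [hv1.1.pos_iff hα.1 hp, hv1.1.map_pos_iff hs hα.1 hp]
    have hadd : A.d v2 (A.g v1) = A.d v2 v1 + A.d v1 (A.g v1) := by
      classical
      have hsep : ∀ α ∈ A.roots, ¬ (0 < ⟪α, v2⟫_ℝ ↔ 0 < ⟪α, v1⟫_ℝ) →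
          (0 < ⟪α, A.g v1⟫_ℝ ↔ 0 < ⟪α, v1⟫_ℝ) := by
        intro α hα h
        by_cases hp : ⟪α, p⟫_ℝ = 0
        · have hαp := mem_rootsAt.2 ⟨hα, hp⟩
          refine hgsame hv1.1 hcl1 hk1 α hαp fun h0 => h (hsame α hαp ?_)
          exact hgen1 α hαp h0 k2 hk2
        · exact absurd (by rw [hv2p.pos_iff hα hp, hv1.1.pos_iff hα hp]) h
      rw [d, d, d, ← Finset.card_union_of_disjoint]
      · congr 1
        ext α
        simp only [Finset.mem_union, mem_sep]
        by_cases hα : α ∈ A.roots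
        · have := hsep α hα
          rw [hv1.1.1.map.neg_iff hα, hv1.1.1.neg_iff hα]
          tauto
        · simp [hα]
      · rw [Finset.disjoint_left]
        intro α h1 h2
        rw [mem_sep] at h1 h2
        linarith [h1.2.2, h2.2.1]
    have hE : A.Rel p v1 v2 := .single ⟨hv1.1, hv2p, hlen.symm, Or.inr (Or.inr (by
      rw [hadd, hlen, len, add_comm]))⟩
    refine (hr1.trans hE).trans ((hpass (mem_eig.1 hk2).1 hk20 hq (hv1.rel hE) hv1' hv2q ?_).trans
      hr2.symm)
    exact (hq.star_iff_inClosure hv1'.1).2 hcl2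
  by_cases hl2' : l = -2
  · -- `g` acts by `-1`
    subst hl2'
    have hneg : ∀ x ∈ A.rootSpan p, A.g x = -x := by
      intro x hx
      have h1 := inner_self_T (A := A) x
      have h2 := hl x hx
      have h3 : ⟪A.g x + x, A.g x + x⟫_ℝ ≤ 0 := by
        have h4 := real_inner_comm x (A.g x)
        rw [inner_add_left, inner_add_right, inner_add_right, LinearIsometryEquiv.inner_map_map]
        linarith
      exact eq_neg_of_add_eq_zero_left
        (inner_self_eq_zero (𝕜 := ℝ).1 (le_antisymm h3 real_inner_self_nonneg))
    obtain ⟨q, hq⟩ := A.exists_refines p v'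
    obtain ⟨w, hw, hc⟩ := exists_cyc_star hq (fun u β hu hβ hβp hβu _ => by
      left
      have h1 := hneg β (Submodule.subset_span (mem_rootsAt.2 ⟨hβ, hβp⟩))
      have h2 : A.g.symm β = -β := by
        rw [← LinearIsometryEquiv.symm_apply_apply A.g (-β), map_neg A.g, h1, neg_neg]
      rw [inner_map_right, h2, inner_neg_left]
      linarith) hv.1
    have hr := hv.rel_of_cyc hc
    refine hr.trans (rel_of_sep_rootsAt (hv.rel hr) hv' fun α hα h1 h2 => ?_)
    have hα' := mem_rootsAt.1 hα
    have := hw.neg A hα'.1 ((hq.neg hα'.1).2 (Or.inr ⟨hα'.2, h2⟩))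
    linarith
  -- the remaining eigenvalues are not real, and eigenspheres are connected
  obtain ⟨θ, h0, hπ, rfl⟩ : ∃ θ, 0 < θ ∧ θ < Real.pi ∧ l = 2 * Real.cos θ := by
    have h1 : l / 2 < 1 := by
      have := lt_of_le_of_ne hlbd.2 hl2; linarith
    have h2 : -1 < l / 2 := by
      have := lt_of_le_of_ne hlbd.1 (Ne.symm hl2'); linarith
    refine ⟨Real.arccos (l / 2), Real.arccos_pos.2 h1, ?_, ?_⟩
    · refine lt_of_le_of_ne (Real.arccos_le_pi _) fun h => ?_
      rw [Real.arccos_eq_pi] at h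
      linarith
    · rw [Real.cos_arccos h2.le h1.le]; ring
  by_contra hnot
  set K := A.eig p (2 * Real.cos θ)
  have hunit : ∀ {k : V} (hk : k ∈ K) (hk0 : k ≠ 0) {w : V}, A.InClosure p w k →
      ∃ z : K, z ∈ Metric.sphere (0 : K) 1 ∧ A.InClosure p w z := by
    intro k hk hk0 w hw
    refine ⟨⟨‖k‖⁻¹ • k, Submodule.smul_mem _ _ hk⟩, ?_, hw.smul (by positivity)⟩
    rw [mem_sphere_zero_iff_norm, Submodule.coe_norm, norm_smul]
    simp [hk0]
  obtain ⟨z1, hz1, hz1c⟩ := hunit hk1 hk10 hcl1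
  obtain ⟨z2, hz2, hz2c⟩ := hunit hk2 hk20 hcl2
  have hconn := isPreconnected_closed_iff.1 (isPreconnected_sphere_eig hs hl2 hl2' hneig)
    (Subtype.val ⁻¹' {k | ∃ u, A.Rel p v u ∧ A.InClosure p u k})
    (Subtype.val ⁻¹' {k | ∃ u, (A.IsMin p u ∧ ¬ A.Rel p v u) ∧ A.InClosure p u k})
    ((isClosed_inClosure p _).preimage continuous_subtype_val)
    ((isClosed_inClosure p _).preimage continuous_subtype_val)
    (fun k _ => by
      obtain ⟨u, hu, hcl⟩ := exists_isMin_inClosure hs h0 hπ hl hneig hv k.2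
      by_cases h : A.Rel p v u
      · exact Or.inl ⟨u, h, hcl⟩
      · exact Or.inr ⟨u, ⟨hu, h⟩, hcl⟩)
    ⟨z1, hz1, v1, hr1, hz1c⟩
    ⟨z2, hz2, v1', ⟨hv1', fun h => hnot (h.trans hr2.symm)⟩, hz2c⟩
  obtain ⟨k, hk, ⟨u, hu, hcl⟩, u', ⟨hu', hnr⟩, hcl'⟩ := hconn
  obtain ⟨q, hq⟩ := A.exists_refines p (k : V)
  have hup := hv.rel hu
  refine hnr (hu.trans (hpass (mem_eig.1 k.2).1 (fun h => ?_) hq hup hu'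
    ((hq.star_iff_inClosure hup.1).2 hcl) ((hq.star_iff_inClosure hu'.1).2 hcl')))
  rw [mem_sphere_zero_iff_norm, Submodule.coe_norm, h] at hk
  simp at hk

end RootArrangement

end

section
open Real

namespace CoxeterForm
variable {I : Type*} [Fintype I] [DecidableEq I] (M : CoxeterMatrix I)

/-- The bilinear form with `B(e_i, e_j) = -cos (π / M i j)`. -/
noncomputable def form : LinearMap.BilinForm ℝ (I → ℝ) :=
  Matrix.toBilin' (Matrix.of fun i j ↦ -cos (π / M i j))

/-- The simple root `e_i`. -/
def simpleRoot (i : I) : I → ℝ := Pi.single i 1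

theorem form_simpleRoot (i j : I) :
    form M (simpleRoot i) (simpleRoot j) = -cos (π / M i j) := by
  simp [form, simpleRoot]

theorem form_self (i : I) : form M (simpleRoot i) (simpleRoot i) = 1 := by
  simp [form_simpleRoot]

theorem form_comm (x y : I → ℝ) : form M x y = form M y x := by
  simp only [form, Matrix.toBilin'_apply, Matrix.of_apply]
  rw [Finset.sum_comm]
  refine Finset.sum_congr rfl fun i _ ↦ Finset.sum_congr rfl fun j _ ↦ ?_
  rw [M.symmetric]
  ring

/-- The reflection `x ↦ x - 2 B(e_i, x) e_i`. -/
noncomputable def refl (i : I) : Module.End ℝ (I → ℝ) :=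
  LinearMap.id - ((2 : ℝ) • form M (simpleRoot i)).smulRight (simpleRoot i)

theorem refl_apply (i : I) (x : I → ℝ) :
    refl M i x = x - (2 * form M (simpleRoot i) x) • simpleRoot i := by
  simp [refl]

theorem form_refl (i : I) (x y : I → ℝ) : form M (refl M i x) (refl M i y) = form M x y := by
  simp only [refl_apply, map_sub, map_smul, LinearMap.sub_apply, LinearMap.smul_apply, form_self,
    smul_eq_mul]
  rw [form_comm M x (simpleRoot i)]
  ring

theorem refl_simpleRoot_self (i : I) : refl M i (simpleRoot i) = -simpleRoot i := by
  rw [refl_apply, form_self]; module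

theorem refl_simpleRoot (i j : I) :
    refl M i (simpleRoot j) = simpleRoot j + (2 * cos (π / M i j)) • simpleRoot i := by
  rw [refl_apply, form_simpleRoot]; module

theorem refl_mul_self (i : I) : refl M i * refl M i = 1 := by
  refine LinearMap.ext fun x ↦ ?_
  rw [Module.End.mul_apply, refl_apply M i x, map_sub, map_smul, refl_simpleRoot_self,
    refl_apply M i x, Module.End.one_apply]
  module

theorem sin_smul_pow (i j : I) (k : ℕ) :
    sin (π / M i j) • ((refl M i * refl M j) ^ k) (simpleRoot i) =
      sin ((2 * k + 1) * (π / M i j)) • simpleRoot i + sin (2 * k * (π / M i j)) • simpleRoot j ∧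
    sin (π / M i j) • ((refl M i * refl M j) ^ k) (simpleRoot j) =
      -sin (2 * k * (π / M i j)) • simpleRoot i
        - sin ((2 * k - 1) * (π / M i j)) • simpleRoot j := by
  set φ := π / M i j with hφ
  have hji : π / M j i = φ := by rw [hφ, M.symmetric]
  induction k with
  | zero => 
    simp [neg_mul]
  | succ k ih =>
    obtain ⟨h1, h2⟩ := ih
    have hadd : ∀ a : ℝ, sin (a * φ + φ) + sin (a * φ - φ) = 2 * cos φ * sin (a * φ) := by
      intro a; rw [sin_add, sin_sub]; ring
    simp only [pow_succ', Module.End.mul_apply (refl M i * refl M j), ← map_smul, h1, h2]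
    simp only [Module.End.mul_apply, map_add, map_sub, map_smul,
      refl_simpleRoot M i j, refl_simpleRoot M j i, refl_simpleRoot_self, hji, ← hφ, map_neg]
    have e1 := hadd (2 * k)
    have e2 := hadd (2 * k + 1)
    have e3 := hadd (2 * k + 2)
    have a1 : (2 * (k:ℝ)) * φ + φ = (2 * k + 1) * φ := by ring
    have a2 : (2 * (k:ℝ)) * φ - φ = (2 * k - 1) * φ := by ring
    have a3 : (2 * (k:ℝ) + 1) * φ + φ = (2 * k + 2) * φ := by ring
    have a4 : (2 * (k:ℝ) + 1) * φ - φ = (2 * k) * φ := by ring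
    have a5 : (2 * (k:ℝ) + 2) * φ + φ = (2 * k + 3) * φ := by ring
    have a6 : (2 * (k:ℝ) + 2) * φ - φ = (2 * k + 1) * φ := by ring
    have b1 : (2 * ((k + 1 : ℕ) : ℝ) + 1) * φ = (2 * k + 3) * φ := by push_cast; ring
    have b2 : (2 * ((k + 1 : ℕ) : ℝ)) * φ = (2 * k + 2) * φ := by push_cast; ring
    have b3 : (2 * ((k + 1 : ℕ) : ℝ) - 1) * φ = (2 * k + 1) * φ := by push_cast; ring
    rw [a1, a2] at e1
    rw [a3, a4] at e2
    rw [a5, a6] at e3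
    rw [b1, b2, b3]
    have e3' : sin ((2 * k + 3) * φ) = 2 * cos φ * sin ((2 * k + 2) * φ)
      - sin ((2 * k + 1) * φ) := by linarith
    have e2' : sin ((2 * k + 2) * φ) = 2 * cos φ * sin ((2 * k + 1) * φ)
      - sin ((2 * k) * φ) := by linarith
    have e1' : sin ((2 * k - 1) * φ) = 2 * cos φ * sin ((2 * k) * φ)
      - sin ((2 * k + 1) * φ) := by linarith
    rw [e3', e2', e1']
    constructor <;> module

theorem isLiftable_refl : M.IsLiftable (refl M) := by
  intro i j
  rcases eq_or_ne i j with rfl | hij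
  · simp [refl_mul_self]
  rcases Nat.eq_zero_or_pos (M i j) with h0 | hpos
  · simp [h0]
  have hM : 2 ≤ M i j := by have := M.off_diagonal i j hij; lia
  set φ := π / M i j with hφ
  have hMR : (2 : ℝ) ≤ M i j := by exact_mod_cast hM
  have hMφ : M i j * φ = π := by rw [hφ]; field_simp
  have hsin : 0 < sin φ := by
    apply sin_pos_of_pos_of_lt_pi
    · positivity
    · nlinarith [pi_pos, show 0 < φ by positivity]
  have hji : cos (π / M j i) = cos φ := by rw [hφ, M.symmetric]
  have hs : sin φ ^ 2 + cos φ ^ 2 = 1 := sin_sq_add_cos_sq φ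
  obtain ⟨h1, h2⟩ := sin_smul_pow M i j (M i j)
  rw [← hφ] at h1 h2
  have c1 : sin ((2 * M i j + 1) * φ) = sin φ := by
    rw [show (2 * (M i j : ℝ) + 1) * φ = φ + 2 * (M i j * φ) by ring, hMφ, sin_add_two_pi]
  have c2 : sin (2 * M i j * φ) = 0 := by
    rw [show 2 * (M i j : ℝ) * φ = 2 * (M i j * φ) by ring, hMφ, sin_two_pi]
  have c3 : sin ((2 * M i j - 1) * φ) = -sin φ := by
    rw [show (2 * (M i j : ℝ) - 1) * φ = 2 * (M i j * φ) - φ by ring, hMφ, sin_two_pi_sub]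
  rw [c1, c2, zero_smul, add_zero] at h1
  rw [c2, c3, neg_zero, zero_smul, zero_sub, neg_smul, neg_neg] at h2
  have h1' := smul_right_injective _ hsin.ne' h1
  have h2' := smul_right_injective _ hsin.ne' h2
  refine LinearMap.ext fun x ↦ ?_
  set a := (form M (simpleRoot i) x + cos φ * form M (simpleRoot j) x) / sin φ ^ 2 with ha
  set b := (form M (simpleRoot j) x + cos φ * form M (simpleRoot i) x) / sin φ ^ 2 with hb
  have hsn : sin φ ^ 2 ≠ 0 := by positivity
  have ha' : a * sin φ ^ 2 = form M (simpleRoot i) x + cos φ * form M (simpleRoot j) x := by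
    rw [ha]; field_simp
  have hb' : b * sin φ ^ 2 = form M (simpleRoot j) x + cos φ * form M (simpleRoot i) x := by
    rw [hb]; field_simp
  set y := x - a • simpleRoot i - b • simpleRoot j with hy
  have hyi : form M (simpleRoot i) y = 0 := by
    simp only [hy, map_sub, map_smul, form_self, form_simpleRoot, ← hφ, smul_eq_mul]
    apply mul_right_cancel₀ hsn
    linear_combination (-1) * ha' + cos φ * hb' + (form M (simpleRoot i) x) * hs
  have hyj : form M (simpleRoot j) y = 0 := by
    simp only [hy, map_sub, map_smul, form_self, form_simpleRoot, hji, smul_eq_mul]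
    apply mul_right_cancel₀ hsn
    linear_combination (-1) * hb' + cos φ * ha' + (form M (simpleRoot j) x) * hs
  have hfix : (refl M i * refl M j) y = y := by
    rw [Module.End.mul_apply, refl_apply M j, hyj, refl_apply]
    simp [hyi]
  have hfixk : ∀ k : ℕ, ((refl M i * refl M j) ^ k) y = y := by
    intro k
    induction k with
    | zero => rfl
    | succ k ih => rw [pow_succ, Module.End.mul_apply, hfix, ih]
  have hx : x = y + a • simpleRoot i + b • simpleRoot j := by rw [hy]; module
  rw [hx, map_add, map_add, map_smul, map_smul, hfixk, h1', h2', Module.End.one_apply]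

end CoxeterForm

end

section
open Real

namespace CoxeterForm
variable {I : Type*} [Fintype I] [DecidableEq I] {M : CoxeterMatrix I}
  {W : Type*} [Group W] (cs : CoxeterSystem M W)

/-- The geometric representation. -/
noncomputable def rep : W →* Module.End ℝ (I → ℝ) :=
  cs.lift ⟨refl M, isLiftable_refl M⟩

theorem rep_simple (i : I) : rep cs (cs.simple i) = refl M i :=
  cs.lift_apply_simple (isLiftable_refl M) i

theorem form_rep (w : W) (x y : I → ℝ) : form M (rep cs w x) (rep cs w y) = form M x y := by
  induction w using cs.simple_induction_left generalizing x y with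
  | one => simp
  | mul_simple_left w i ih =>
    rw [map_mul, Module.End.mul_apply, Module.End.mul_apply, rep_simple, form_refl, ih]

/-- The Chebyshev-type sequence governing dihedral orbits of simple roots. -/
noncomputable def cheb (c : ℝ) : ℕ → ℝ
  | 0 => 0
  | 1 => 1
  | k + 2 => 2 * c * cheb c (k + 1) - cheb c k

theorem cheb_mul_sin (φ : ℝ) (k : ℕ) :
    cheb (cos φ) k * sin φ = sin (k * φ) ∧ cheb (cos φ) (k + 1) * sin φ = sin ((k + 1) * φ) := by
  induction k with
  | zero => simp [cheb]
  | succ k ih =>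
    obtain ⟨h1, h2⟩ := ih
    refine ⟨by push_cast; exact h2, ?_⟩
    have e1 : ((k + 1 : ℕ) + 1 : ℝ) * φ = (k + 1) * φ + φ := by push_cast; ring
    have e2 : (k : ℝ) * φ = (k + 1) * φ - φ := by ring
    rw [e1, sin_add]
    rw [e2, sin_sub] at h1
    rw [cheb, sub_mul, mul_assoc, h2, h1]
    ring

theorem cheb_one (k : ℕ) : cheb 1 k = k ∧ cheb 1 (k + 1) = k + 1 := by
  induction k with
  | zero => simp [cheb]
  | succ k ih =>
    obtain ⟨h1, h2⟩ := ih
    refine ⟨by push_cast; exact h2, ?_⟩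
    rw [cheb, h1, h2]; push_cast; ring

theorem cheb_nonneg {m k : ℕ} (hm1 : m ≠ 1) (hk : m = 0 ∨ k ≤ m) : 0 ≤ cheb (cos (π / m)) k := by
  rcases Nat.eq_zero_or_pos m with rfl | hpos
  · simp [(cheb_one k).1]
  have hkm : k ≤ m := by lia
  have hm : (2 : ℝ) ≤ m := by exact_mod_cast (show 2 ≤ m by lia)
  have hmφ : m * (π / m) = π := by field_simp
  have hφ : 0 < π / m := by positivity
  have hsin : 0 < sin (π / m) := sin_pos_of_pos_of_lt_pi hφ (by nlinarith)
  have hkm' : (k : ℝ) ≤ m := by exact_mod_cast hkm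
  have hs : 0 ≤ sin (k * (π / m)) :=
    sin_nonneg_of_nonneg_of_le_pi (by positivity) (by nlinarith)
  rw [← (cheb_mul_sin _ k).1] at hs
  exact nonneg_of_mul_nonneg_left hs hsin

theorem rep_alternatingWord (s t : I) (k : ℕ) :
    rep cs (cs.wordProd (CoxeterSystem.alternatingWord s t k)) (simpleRoot s) =
      cheb (cos (π / M s t)) (k + 1) • simpleRoot (if Even k then s else t) +
      cheb (cos (π / M s t)) k • simpleRoot (if Even k then t else s) := by
  induction k with
  | zero => simp [CoxeterSystem.alternatingWord, cheb]
  | succ k ih =>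
    rw [CoxeterSystem.alternatingWord_succ', cs.wordProd_cons, map_mul, Module.End.mul_apply, ih,
      rep_simple, cheb]
    have hts : M t s = M s t := M.symmetric t s
    by_cases hk : Even k
    · have hk' : ¬ Even (k + 1) := by rwa [Nat.even_add_one, not_not]
      simp only [hk, hk', if_true, if_false, map_add, map_smul, refl_simpleRoot M t s,
        refl_simpleRoot_self, hts]
      module
    · have hk' : Even (k + 1) := by rwa [Nat.even_add_one]
      simp only [hk, hk', if_true, if_false, map_add, map_smul, refl_simpleRoot M s t,
        refl_simpleRoot_self]
      module

theorem rep_simpleRoot_nonneg (w : W) (s : I) (hs : cs.length w < cs.length (w * cs.simple s))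
    (j : I) : 0 ≤ rep cs w (simpleRoot s) j := by
  induction hn : cs.length w using Nat.strong_induction_on generalizing w s with
  | _ n ih =>
  subst hn
  rcases eq_or_ne w 1 with rfl | hw
  · simp only [map_one, Module.End.one_apply, simpleRoot, Pi.single_apply]
    split <;> norm_num
  obtain ⟨t, ht⟩ := cs.exists_rightDescent_of_ne_one hw
  rw [CoxeterSystem.IsRightDescent] at ht
  have hst : s ≠ t := by rintro rfl; lia
  set P : ℕ → Prop := fun k ↦ ∃ v, w = v * cs.wordProd (CoxeterSystem.alternatingWord s t k) ∧
    cs.length w = cs.length v + k with hP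
  have hP1 : P 1 := by
    refine ⟨w * cs.simple t, by simp [CoxeterSystem.alternatingWord], ?_⟩
    rcases cs.length_mul_simple w t with h | h <;> lia
  obtain ⟨k, hk1, hPk, hmax⟩ : ∃ k, 1 ≤ k ∧ P k ∧ ¬ P (k + 1) := by
    by_contra! hcon
    have hall : ∀ k, P (k + 1) := by
      intro k
      induction k with
      | zero => exact hP1
      | succ k ih => exact hcon _ (by lia) ih
    obtain ⟨v, -, hv⟩ := hall (cs.length w)
    lia
  obtain ⟨v, hwv, hlen⟩ := hPk
  obtain ⟨k, rfl⟩ : ∃ k', k = k' + 1 := ⟨k - 1, by lia⟩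
  have hy : cs.length v < cs.length (v * cs.simple (if Even (k + 1) then t else s)) := by
    by_contra hcon
    refine hmax ⟨v * cs.simple (if Even (k + 1) then t else s), ?_, ?_⟩
    · rw [CoxeterSystem.alternatingWord_succ', cs.wordProd_cons, ← mul_assoc,
        cs.simple_mul_simple_cancel_right, hwv]
    · rcases cs.length_mul_simple v (if Even (k + 1) then t else s) with h | h <;> lia
  have hx : cs.length v < cs.length (v * cs.simple (if Even (k + 1) then s else t)) := by
    have h1 : w = v * cs.simple (if Even (k + 1) then s else t) *
        cs.wordProd (CoxeterSystem.alternatingWord s t k) := by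
      rw [hwv, CoxeterSystem.alternatingWord_succ', cs.wordProd_cons, mul_assoc]
      by_cases hk : Even k
      · have hk' : ¬ Even (k + 1) := by rwa [Nat.even_add_one, not_not]
        simp [hk, hk']
      · have hk' : Even (k + 1) := by rwa [Nat.even_add_one]
        simp [hk, hk']
    have h2 := cs.length_mul_le (v * cs.simple (if Even (k + 1) then s else t))
      (cs.wordProd (CoxeterSystem.alternatingWord s t k))
    have h3 := cs.length_wordProd_le (CoxeterSystem.alternatingWord s t k)
    rw [← h1] at h2
    rw [CoxeterSystem.length_alternatingWord] at h3
    lia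
  have hkm : M s t = 0 ∨ k + 2 ≤ M s t := by
    by_contra! hcon
    obtain ⟨hm0, hkm⟩ := hcon
    have hts : M t s = M s t := M.symmetric t s
    refine cs.not_isReduced_alternatingWord t s (m := k + 2) (by rwa [hts]) (by rw [hts]; lia) ?_
    have h1 : w * cs.simple s = v * cs.wordProd (CoxeterSystem.alternatingWord t s (k + 2)) := by
      rw [CoxeterSystem.alternatingWord_succ, cs.wordProd_concat, ← mul_assoc, hwv]
    have h2 := cs.length_mul_le v (cs.wordProd (CoxeterSystem.alternatingWord t s (k + 2)))
    have h3 := cs.length_wordProd_le (CoxeterSystem.alternatingWord t s (k + 2))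
    rw [← h1] at h2
    rw [CoxeterSystem.IsReduced]
    rw [CoxeterSystem.length_alternatingWord] at h3 ⊢
    lia
  have hM1 : M s t ≠ 1 := M.off_diagonal s t hst
  rw [hwv, map_mul, Module.End.mul_apply, rep_alternatingWord, map_add, map_smul, map_smul,
    Pi.add_apply, Pi.smul_apply, Pi.smul_apply, smul_eq_mul, smul_eq_mul]
  exact add_nonneg
    (mul_nonneg (cheb_nonneg hM1 (by lia)) (ih (cs.length v) (by lia) v _ hx rfl))
    (mul_nonneg (cheb_nonneg hM1 (by lia)) (ih (cs.length v) (by lia) v _ hy rfl))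

end CoxeterForm

end

section
open scoped InnerProductSpace

/-- A Euclidean realization of a Coxeter system together with a diagram automorphism. -/
structure Realization {I : Type*} [Fintype I] {M : CoxeterMatrix I} {W : Type*} [Group W]
    (cs : CoxeterSystem M W) (δ : I ≃ I) (δW : W ≃* W)
    (V : Type*) [NormedAddCommGroup V] [InnerProductSpace ℝ V] where
  e : I → V
  σ : W →* (V ≃ₗᵢ[ℝ] V)
  D : V ≃ₗᵢ[ℝ] V
  exists_inner : ∀ f : I → ℝ, ∃ p : V, ∀ i, ⟪e i, p⟫_ℝ = f i
  ext_inner : ∀ x y : V, (∀ i, ⟪e i, x⟫_ℝ = ⟪e i, y⟫_ℝ) → x = y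
  simple_apply : ∀ i x, ∃ c : ℝ, σ (cs.simple i) x = x - c • e i
  simple_e : ∀ i, σ (cs.simple i) (e i) = -e i
  nonneg : ∀ w i, cs.length w < cs.length (w * cs.simple i) →
    ∃ a : I → ℝ, (∀ j, 0 ≤ a j) ∧ σ w (e i) = ∑ j, a j • e j
  reduced : ∀ w w' i i' (c : ℝ), σ w (e i) = c • σ w' (e i') → c = 1 ∨ c = -1
  D_e : ∀ i, D (e i) = e (δ i)
  D_σ : ∀ w x, D (σ w x) = σ (δW w) (D x)

namespace CoxeterForm
variable {I : Type*} [Fintype I] [DecidableEq I] {M : CoxeterMatrix I}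
  {W : Type*} [Group W] (cs : CoxeterSystem M W)

theorem simpleRoot_comp_symm {I : Type*} [DecidableEq I] (δ : I ≃ I) (i : I) :
    simpleRoot i ∘ δ.symm = simpleRoot (δ i) := by
  ext j
  simp [simpleRoot, Pi.single_apply, Equiv.symm_apply_eq]

theorem form_comp_symm (δ : I ≃ I) (hδM : ∀ i j : I, M (δ i) (δ j) = M i j) (x y : I → ℝ) :
    form M (x ∘ δ.symm) (y ∘ δ.symm) = form M x y := by
  simp only [form, Matrix.toBilin'_apply, Matrix.of_apply, Function.comp_apply]
  rw [← Equiv.sum_comp δ]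
  refine Finset.sum_congr rfl fun i _ ↦ ?_
  rw [← Equiv.sum_comp δ]
  refine Finset.sum_congr rfl fun j _ ↦ ?_
  simp [hδM]

theorem refl_comp_symm (δ : I ≃ I) (hδM : ∀ i j : I, M (δ i) (δ j) = M i j) (i : I) (x : I → ℝ) :
    refl M i x ∘ δ.symm = refl M (δ i) (x ∘ δ.symm) := by
  rw [refl_apply, refl_apply, ← simpleRoot_comp_symm, form_comp_symm δ hδM]
  rfl

theorem rep_comp_symm (δ : I ≃ I) (hδM : ∀ i j : I, M (δ i) (δ j) = M i j) (δW : W ≃* W)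
    (hδW : ∀ i, δW (cs.simple i) = cs.simple (δ i)) (w : W) (x : I → ℝ) :
    rep cs w x ∘ δ.symm = rep cs (δW w) (x ∘ δ.symm) := by
  induction w using cs.simple_induction_left generalizing x with
  | one => simp
  | mul_simple_left w i ih =>
    rw [map_mul, map_mul, map_mul, Module.End.mul_apply, Module.End.mul_apply, hδW, rep_simple,
      rep_simple, refl_comp_symm δ hδM, ih]

/-- The orbit map into a Euclidean space of functions; pulling back the inner product along it
averages the standard inner product over the group. -/
noncomputable def orbitMap : (I → ℝ) →ₗ[ℝ] EuclideanSpace ℝ (W × I) where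
  toFun x := WithLp.toLp 2 fun p ↦ rep cs p.1 x p.2
  map_add' x y := by ext; simp
  map_smul' c x := by ext; simp

theorem orbitMap_injective : Function.Injective (orbitMap cs) := by
  intro x y h
  ext i
  have := congrArg (fun z : EuclideanSpace ℝ (W × I) ↦ z (1, i)) h
  simpa [orbitMap] using this

variable [Fintype W]

theorem inner_orbitMap (x y : I → ℝ) :
    ⟪orbitMap cs x, orbitMap cs y⟫_ℝ = ∑ w, ∑ i, rep cs w x i * rep cs w y i := by
  rw [PiLp.inner_apply, Fintype.sum_prod_type]
  simp [orbitMap, mul_comm]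

theorem inner_orbitMap_rep (w : W) (x y : I → ℝ) :
    ⟪orbitMap cs (rep cs w x), orbitMap cs (rep cs w y)⟫_ℝ =
      ⟪orbitMap cs x, orbitMap cs y⟫_ℝ := by
  rw [inner_orbitMap, inner_orbitMap]
  exact Fintype.sum_equiv (Equiv.mulRight w) _ _ fun w' ↦ by simp

theorem inner_orbitMap_comp_symm (δ : I ≃ I) (hδM : ∀ i j : I, M (δ i) (δ j) = M i j)
    (δW : W ≃* W) (hδW : ∀ i, δW (cs.simple i) = cs.simple (δ i)) (x y : I → ℝ) :
    ⟪orbitMap cs (x ∘ δ.symm), orbitMap cs (y ∘ δ.symm)⟫_ℝ =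
      ⟪orbitMap cs x, orbitMap cs y⟫_ℝ := by
  rw [inner_orbitMap, inner_orbitMap]
  refine (Fintype.sum_equiv δW.toEquiv _ _ fun w ↦ Fintype.sum_equiv δ _ _ fun i ↦ ?_).symm
  simp [← rep_comp_symm cs δ hδM δW hδW]

end CoxeterForm

/-- Transport of an isometric linear automorphism along a linear equivalence. -/
noncomputable def isometryConj {E V : Type*} [AddCommGroup E] [Module ℝ E] [NormedAddCommGroup V]
    [InnerProductSpace ℝ V] (T : E ≃ₗ[ℝ] V) (f : E ≃ₗ[ℝ] E)
    (hf : ∀ x y, ⟪T (f x), T (f y)⟫_ℝ = ⟪T x, T y⟫_ℝ) : V ≃ₗᵢ[ℝ] V where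
  toLinearEquiv := (T.symm.trans f).trans T
  norm_map' v := by
    obtain ⟨x, rfl⟩ := T.surjective v
    have := hf x x
    rw [real_inner_self_eq_norm_sq, real_inner_self_eq_norm_sq] at this
    simpa using (pow_left_inj₀ (norm_nonneg _) (norm_nonneg _) two_ne_zero).1 this

theorem isometryConj_apply {E V : Type*} [AddCommGroup E] [Module ℝ E] [NormedAddCommGroup V]
    [InnerProductSpace ℝ V] (T : E ≃ₗ[ℝ] V) (f : E ≃ₗ[ℝ] E)
    (hf : ∀ x y, ⟪T (f x), T (f y)⟫_ℝ = ⟪T x, T y⟫_ℝ) (x : E) :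
    isometryConj T f hf (T x) = T (f x) := by
  simp [isometryConj]

universe u v in
open CoxeterForm in
theorem exists_realization {I : Type u} [Fintype I] {M : CoxeterMatrix I} {W : Type v}
    [Group W] [Finite W] (cs : CoxeterSystem M W) (δ : I ≃ I)
    (hδM : ∀ i j : I, M (δ i) (δ j) = M i j) (δW : W ≃* W)
    (hδW : ∀ i, δW (cs.simple i) = cs.simple (δ i)) :
    ∃ (V : Type max u v) (_ : NormedAddCommGroup V) (_ : InnerProductSpace ℝ V)
      (_ : FiniteDimensional ℝ V), Nonempty (Realization cs δ δW V) := by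
  classical
  have := Fintype.ofFinite W
  set T := LinearEquiv.ofInjective (orbitMap cs) (orbitMap_injective cs) with hT
  have hinner : ∀ x y, ⟪T x, T y⟫_ℝ = ⟪orbitMap cs x, orbitMap cs y⟫_ℝ := fun x y ↦ rfl
  have hinv : ∀ w, rep cs w * rep cs w⁻¹ = 1 := fun w ↦ by rw [← map_mul]; simp
  have hinv' : ∀ w, rep cs w⁻¹ * rep cs w = 1 := fun w ↦ by rw [← map_mul]; simp
  set R : W → ((I → ℝ) ≃ₗ[ℝ] (I → ℝ)) := fun w ↦
    LinearEquiv.ofLinearMap (rep cs w) (rep cs w⁻¹) (hinv w) (hinv' w) with hR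
  have hRinv : ∀ w x y, ⟪T (R w x), T (R w y)⟫_ℝ = ⟪T x, T y⟫_ℝ := fun w x y ↦ by
    simpa [hinner, hR] using inner_orbitMap_rep cs w x y
  set Δ : (I → ℝ) ≃ₗ[ℝ] (I → ℝ) := LinearEquiv.funCongrLeft ℝ ℝ δ.symm with hΔ
  have hΔa : ∀ x, Δ x = x ∘ δ.symm := fun x ↦ rfl
  have hΔinv : ∀ x y, ⟪T (Δ x), T (Δ y)⟫_ℝ = ⟪T x, T y⟫_ℝ := fun x y ↦ by
    simpa [hinner, hΔa] using inner_orbitMap_comp_symm cs δ hδM δW hδW x y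
  have hσT : ∀ w x, isometryConj T (R w) (hRinv w) (T x) = T (rep cs w x) := fun w x ↦
    isometryConj_apply _ _ _ _
  set b : Module.Basis I ℝ (LinearMap.range (orbitMap cs)) := (Pi.basisFun ℝ I).map T with hb
  have hbe : ∀ i, b i = T (simpleRoot i) := fun i ↦ by simp [hb, simpleRoot]
  refine ⟨LinearMap.range (orbitMap cs), inferInstance, inferInstance, inferInstance, ⟨{
    e := fun i ↦ T (simpleRoot i)
    σ := {
      toFun := fun w ↦ isometryConj T (R w) (hRinv w)
      map_one' := ?_
      map_mul' := ?_ }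
    D := isometryConj T Δ hΔinv
    exists_inner := ?_
    ext_inner := ?_
    simple_apply := ?_
    simple_e := ?_
    nonneg := ?_
    reduced := ?_
    D_e := ?_
    D_σ := ?_ }⟩⟩
  · ext1 v
    obtain ⟨x, rfl⟩ := T.surjective v
    rw [hσT]; simp
  · intro w w'
    ext1 v
    obtain ⟨x, rfl⟩ := T.surjective v
    rw [hσT, LinearIsometryEquiv.coe_mul, Function.comp_apply, hσT, hσT, map_mul,
      Module.End.mul_apply]
  · intro f
    refine ⟨(InnerProductSpace.toDual ℝ _).symm (b.constr ℝ f).toContinuousLinearMap, fun i ↦ ?_⟩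
    rw [real_inner_comm, InnerProductSpace.toDual_symm_apply, LinearMap.coe_toContinuousLinearMap',
      ← hbe, b.constr_basis]
  · intro x y h
    refine InnerProductSpace.ext_inner_left_basis b fun i ↦ ?_
    rw [hbe]; exact h i
  · intro i v
    obtain ⟨x, rfl⟩ := T.surjective v
    refine ⟨2 * form M (simpleRoot i) x, ?_⟩
    simp only [MonoidHom.coe_mk, OneHom.coe_mk]
    rw [hσT, rep_simple, refl_apply, map_sub, map_smul]
  · intro i
    simp only [MonoidHom.coe_mk, OneHom.coe_mk]
    rw [hσT, rep_simple, refl_simpleRoot_self, map_neg]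
  · intro w i h
    refine ⟨rep cs w (simpleRoot i), rep_simpleRoot_nonneg cs w i h, ?_⟩
    simp only [MonoidHom.coe_mk, OneHom.coe_mk]
    rw [hσT]
    simp only [← hbe]
    rw [← b.sum_repr (T (rep cs w (simpleRoot i)))]
    refine Finset.sum_congr rfl fun j _ ↦ ?_
    simp [hb]
  · intro w w' i i' c h
    simp only [MonoidHom.coe_mk, OneHom.coe_mk] at h
    rw [hσT, hσT, ← map_smul] at h
    have h' := T.injective h
    have h1 := form_rep cs w (simpleRoot i) (simpleRoot i)
    rw [h', map_smul, LinearMap.map_smul₂, form_rep, form_self, form_self] at h1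
    have : (c - 1) * (c + 1) = 0 := by
      simp only [smul_eq_mul] at h1; linarith
    rcases mul_eq_zero.1 this with h | h
    · left; linarith
    · right; linarith
  · intro i
    rw [isometryConj_apply, hΔa, simpleRoot_comp_symm]
  · intro w v
    obtain ⟨x, rfl⟩ := T.surjective v
    simp only [MonoidHom.coe_mk, OneHom.coe_mk]
    rw [hσT, isometryConj_apply, isometryConj_apply, hσT, hΔa, hΔa, rep_comp_symm cs δ hδM δW hδW]

end

section
open scoped InnerProductSpace

namespace Realization
variable {I : Type*} [Fintype I] {M : CoxeterMatrix I} {W : Type*} [Group W]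
  {cs : CoxeterSystem M W} {δ : I ≃ I} {δW : W ≃* W}
  {V : Type*} [NormedAddCommGroup V] [InnerProductSpace ℝ V] (R : Realization cs δ δW V)

/-- A vector in the open fundamental chamber, pairing to `1` with every simple root. -/
noncomputable def ρ : V := (R.exists_inner fun _ ↦ 1).choose

theorem inner_e_ρ (i : I) : ⟪R.e i, R.ρ⟫_ℝ = 1 := (R.exists_inner fun _ ↦ 1).choose_spec i

theorem σ_mul (w w' : W) (x : V) : R.σ (w * w') x = R.σ w (R.σ w' x) := by
  rw [map_mul, LinearIsometryEquiv.coe_mul, Function.comp_apply]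

theorem σ_inv_σ (w : W) (x : V) : R.σ w⁻¹ (R.σ w x) = x := by
  rw [← R.σ_mul, inv_mul_cancel, map_one, LinearIsometryEquiv.coe_one, id]

theorem σ_σ_inv (w : W) (x : V) : R.σ w (R.σ w⁻¹ x) = x := by
  rw [← R.σ_mul, mul_inv_cancel, map_one, LinearIsometryEquiv.coe_one, id]

theorem inner_σ_left (w : W) (x y : V) : ⟪R.σ w x, y⟫_ℝ = ⟪x, R.σ w⁻¹ y⟫_ℝ := by
  rw [← (R.σ w⁻¹).inner_map_map, R.σ_inv_σ]

theorem inner_σ_right (w : W) (x y : V) : ⟪x, R.σ w y⟫_ℝ = ⟪R.σ w⁻¹ x, y⟫_ℝ := by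
  rw [R.inner_σ_left, inv_inv]

theorem inner_simple_left (i : I) (x y : V) :
    ⟪R.σ (cs.simple i) x, y⟫_ℝ = ⟪x, R.σ (cs.simple i) y⟫_ℝ := by
  rw [R.inner_σ_left, cs.inv_simple]

theorem e_ne_zero (i : I) : R.e i ≠ 0 := by
  intro h
  have := R.inner_e_ρ i
  simp [h] at this

theorem σ_e_ne_zero (w : W) (i : I) : R.σ w (R.e i) ≠ 0 := by
  simpa using R.e_ne_zero i

theorem σ_mul_simple_e (w : W) (i : I) : R.σ (w * cs.simple i) (R.e i) = -R.σ w (R.e i) := by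
  rw [R.σ_mul, R.simple_e, map_neg]

theorem exists_simple_apply (i : I) (x : V) :
    ∃ c : ℝ, R.σ (cs.simple i) x = x - c • R.e i ∧ c * ⟪R.e i, R.e i⟫_ℝ = 2 * ⟪R.e i, x⟫_ℝ := by
  obtain ⟨c, hc⟩ := R.simple_apply i x
  refine ⟨c, hc, ?_⟩
  have h : ⟪R.e i, R.σ (cs.simple i) x⟫_ℝ = -⟪R.e i, x⟫_ℝ := by
    rw [← R.inner_simple_left, R.simple_e, inner_neg_left]
  rw [hc, inner_sub_right, inner_smul_right] at h
  linarith

theorem simple_apply_eq_self {i : I} {x : V} (h : ⟪R.e i, x⟫_ℝ = 0) :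
    R.σ (cs.simple i) x = x := by
  obtain ⟨c, hc, hc'⟩ := R.exists_simple_apply i x
  have : ⟪R.e i, R.e i⟫_ℝ ≠ 0 := fun h0 ↦ R.e_ne_zero i (inner_self_eq_zero.1 h0)
  rw [h, mul_zero] at hc'
  have hc0 : c = 0 := (mul_eq_zero.1 hc').resolve_right this
  rw [hc, hc0, zero_smul, sub_zero]

/-- The pairing with every simple root is nonnegative. -/
def Dominant (p : V) : Prop := ∀ i, 0 ≤ ⟪R.e i, p⟫_ℝ

theorem inner_nonneg {p : V} (hp : R.Dominant p) {w : W} {i : I}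
    (h : cs.length w < cs.length (w * cs.simple i)) : 0 ≤ ⟪R.σ w (R.e i), p⟫_ℝ := by
  obtain ⟨a, ha, h⟩ := R.nonneg w i h
  rw [h, sum_inner]
  refine Finset.sum_nonneg fun j _ ↦ ?_
  rw [real_inner_smul_left]
  exact mul_nonneg (ha j) (hp j)

theorem inner_ρ_pos {w : W} {i : I} (h : cs.length w < cs.length (w * cs.simple i)) :
    0 < ⟪R.σ w (R.e i), R.ρ⟫_ℝ := by
  obtain ⟨a, ha, h⟩ := R.nonneg w i h
  have hsum : ⟪R.σ w (R.e i), R.ρ⟫_ℝ = ∑ j, a j := by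
    rw [h, sum_inner]
    simp [real_inner_smul_left, inner_e_ρ]
  rw [hsum]
  refine (Finset.sum_nonneg fun j _ ↦ ha j).lt_of_ne' fun h0 ↦ R.σ_e_ne_zero w i ?_
  rw [Finset.sum_eq_zero_iff_of_nonneg fun j _ ↦ ha j] at h0
  rw [h]
  exact Finset.sum_eq_zero fun j hj ↦ by rw [h0 j hj, zero_smul]

theorem inner_ρ_neg {w : W} {i : I} (h : cs.length (w * cs.simple i) < cs.length w) :
    ⟪R.σ w (R.e i), R.ρ⟫_ℝ < 0 := by
  have := R.inner_ρ_pos (w := w * cs.simple i) (i := i)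
    (by rwa [cs.simple_mul_simple_cancel_right])
  rw [R.σ_mul_simple_e, inner_neg_left] at this
  linarith

theorem inner_ρ_pos_iff (w : W) (i : I) :
    0 < ⟪R.σ w (R.e i), R.ρ⟫_ℝ ↔ cs.length w < cs.length (w * cs.simple i) := by
  refine ⟨fun h ↦ ?_, R.inner_ρ_pos⟩
  by_contra hcon
  have := R.inner_ρ_neg (w := w) (i := i)
    (lt_of_le_of_ne (not_lt.1 hcon) (cs.length_mul_simple_ne w i))
  linarith

/-- The roots are the images of the simple roots. -/
def IsRoot (α : V) : Prop := ∃ w i, α = R.σ w (R.e i)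

theorem isRoot_e (i : I) : R.IsRoot (R.e i) := ⟨1, i, by simp⟩

variable {R}

theorem IsRoot.neg {α : V} (h : R.IsRoot α) : R.IsRoot (-α) := by
  obtain ⟨w, i, rfl⟩ := h
  exact ⟨w * cs.simple i, i, by rw [R.σ_mul_simple_e]⟩

theorem IsRoot.map {α : V} (h : R.IsRoot α) (w : W) : R.IsRoot (R.σ w α) := by
  obtain ⟨w', i, rfl⟩ := h
  exact ⟨w * w', i, by rw [R.σ_mul]⟩

theorem IsRoot.symm_D {α : V} (h : R.IsRoot α) : R.IsRoot (R.D.symm α) := by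
  obtain ⟨w, i, rfl⟩ := h
  refine ⟨δW.symm w, δ.symm i, R.D.injective ?_⟩
  rw [R.D_σ, R.D_e]
  simp

theorem IsRoot.inner_ρ_ne_zero {α : V} (h : R.IsRoot α) : ⟪α, R.ρ⟫_ℝ ≠ 0 := by
  obtain ⟨w, i, rfl⟩ := h
  rcases lt_or_gt_of_ne (cs.length_mul_simple_ne w i) with h | h
  · exact (R.inner_ρ_neg h).ne
  · exact (R.inner_ρ_pos h).ne'

theorem IsRoot.exists_sum {α : V} (h : R.IsRoot α) (hpos : 0 < ⟪α, R.ρ⟫_ℝ) :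
    ∃ a : I → ℝ, (∀ j, 0 ≤ a j) ∧ α = ∑ j, a j • R.e j := by
  obtain ⟨w, i, rfl⟩ := h
  exact R.nonneg w i ((R.inner_ρ_pos_iff w i).1 hpos)

theorem IsRoot.inner_nonneg {α p : V} (h : R.IsRoot α) (hpos : 0 < ⟪α, R.ρ⟫_ℝ)
    (hp : R.Dominant p) : 0 ≤ ⟪α, p⟫_ℝ := by
  obtain ⟨w, i, rfl⟩ := h
  exact R.inner_nonneg hp ((R.inner_ρ_pos_iff w i).1 hpos)

theorem IsRoot.eq_or_eq_neg {α β : V} (hα : R.IsRoot α) (hβ : R.IsRoot β) {c : ℝ}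
    (h : β = c • α) : β = α ∨ β = -α := by
  obtain ⟨w, i, rfl⟩ := hα
  obtain ⟨w', i', rfl⟩ := hβ
  rcases R.reduced w' w i' i c h with rfl | rfl
  · left; rw [h, one_smul]
  · right; rw [h, neg_one_smul]

theorem IsRoot.simple_pos {α : V} (h : R.IsRoot α) (hpos : 0 < ⟪α, R.ρ⟫_ℝ) {i : I}
    (hi : α ≠ R.e i) : 0 < ⟪R.σ (cs.simple i) α, R.ρ⟫_ℝ := by
  classical
  obtain ⟨p, hp⟩ := R.exists_inner fun j ↦ if j = i then 0 else 1
  have hpd : R.Dominant p := fun j ↦ by rw [hp]; split <;> norm_num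
  obtain ⟨a, ha, hsum⟩ := h.exists_sum hpos
  have hαp : 0 < ⟪α, p⟫_ℝ := by
    have hterm : ⟪α, p⟫_ℝ = ∑ j, if j = i then 0 else a j := by
      rw [hsum, sum_inner]
      refine Finset.sum_congr rfl fun j _ ↦ ?_
      rw [real_inner_smul_left, hp]
      split <;> simp
    have hnn : ∀ j ∈ Finset.univ, 0 ≤ if j = i then 0 else a j := fun j _ ↦ by
      split
      · exact le_rfl
      · exact ha j
    rw [hterm]
    refine (Finset.sum_nonneg hnn).lt_of_ne' fun h0 ↦ ?_
    rw [Finset.sum_eq_zero_iff_of_nonneg hnn] at h0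
    have hα : α = a i • R.e i := by
      rw [hsum]
      refine Finset.sum_eq_single i (fun j hj hji ↦ ?_) (by simp)
      have := h0 j hj
      rw [if_neg hji] at this
      rw [this, zero_smul]
    rcases (R.isRoot_e i).eq_or_eq_neg h hα with h' | h'
    · exact hi h'
    · rw [h', inner_neg_left, R.inner_e_ρ] at hpos
      linarith
  by_contra hcon
  have hroot := h.map (cs.simple i)
  have hneg : 0 < ⟪-R.σ (cs.simple i) α, R.ρ⟫_ℝ := by
    rw [inner_neg_left]
    have := hroot.inner_ρ_ne_zero
    have := lt_of_le_of_ne (not_lt.1 hcon) this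
    linarith
  have h1 := hroot.neg.inner_nonneg hneg hpd
  rw [inner_neg_left, R.inner_simple_left, R.simple_apply_eq_self (by rw [hp, if_pos rfl])] at h1
  linarith

theorem IsRoot.simple_neg_iff {α : V} (h : R.IsRoot α) {i : I} (hi : α ≠ R.e i)
    (hi' : α ≠ -R.e i) : ⟪R.σ (cs.simple i) α, R.ρ⟫_ℝ < 0 ↔ ⟪α, R.ρ⟫_ℝ < 0 := by
  constructor
  · intro h1
    by_contra hcon
    have := h.simple_pos (lt_of_le_of_ne (not_lt.1 hcon) h.inner_ρ_ne_zero.symm) hi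
    linarith
  · intro h1
    have := h.neg.simple_pos (by rw [inner_neg_left]; linarith) (i := i)
      (fun h' ↦ hi' (by rw [← h', neg_neg]))
    rw [map_neg, inner_neg_left] at this
    linarith

variable (R)

theorem D_ρ : R.D R.ρ = R.ρ := by
  refine R.ext_inner _ _ fun i ↦ ?_
  have : R.e i = R.D (R.e (δ.symm i)) := by rw [R.D_e]; simp
  rw [this, R.D.inner_map_map, R.inner_e_ρ, R.D_e, R.inner_e_ρ]

theorem D_symm_ρ : R.D.symm R.ρ = R.ρ := by
  rw [LinearIsometryEquiv.symm_apply_eq, R.D_ρ]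

theorem D_symm_σ (w : W) (x : V) : R.D.symm (R.σ w x) = R.σ (δW.symm w) (R.D.symm x) := by
  rw [LinearIsometryEquiv.symm_apply_eq, R.D_σ]
  simp

theorem parabolic_apply_eq_self {J : Set I} {p : V} (hp : ∀ j ∈ J, ⟪R.e j, p⟫_ℝ = 0) {u : W}
    (hu : u ∈ parabolic cs J) : R.σ u p = p := by
  induction hu using Subgroup.closure_induction with
  | mem x hx =>
    obtain ⟨j, hj, rfl⟩ := hx
    exact R.simple_apply_eq_self (hp j hj)
  | one => simp
  | mul x y _ _ hx hy => rw [R.σ_mul, hy, hx]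
  | inv x _ hx => nth_rw 1 [← hx]; rw [R.σ_inv_σ]

theorem mem_of_simple_mem_parabolic (R : Realization cs δ δW V) {J : Set I} {j : I}
    (hj : cs.simple j ∈ parabolic cs J) :
    j ∈ J := by
  classical
  obtain ⟨p, hp⟩ := R.exists_inner fun i ↦ if i ∈ J then 0 else 1
  have h1 := R.parabolic_apply_eq_self (p := p) (fun i hi ↦ by rw [hp, if_pos hi]) hj
  have h2 : ⟪R.e j, R.σ (cs.simple j) p⟫_ℝ = -⟪R.e j, p⟫_ℝ := by
    rw [← R.inner_simple_left, R.simple_e, inner_neg_left]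
  rw [h1, hp] at h2
  by_contra hcon
  rw [if_neg hcon] at h2
  norm_num at h2

theorem mem_parabolic_of_pos {p : V} (hp : R.Dominant p) {J : Set I}
    (hJ : ∀ i, ⟪R.e i, p⟫_ℝ = 0 → i ∈ J) {u : W}
    (hu : ∀ α, R.IsRoot α → 0 < ⟪α, p⟫_ℝ → 0 < ⟪α, R.σ u R.ρ⟫_ℝ) : u ∈ parabolic cs J := by
  induction hn : cs.length u using Nat.strong_induction_on generalizing u with
  | _ n ih =>
  subst hn
  rcases eq_or_ne u 1 with rfl | hu1
  · exact one_mem _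
  obtain ⟨i, hi⟩ := cs.exists_leftDescent_of_ne_one hu1
  have hi' : cs.length (u⁻¹ * cs.simple i) < cs.length u⁻¹ := by
    rw [← cs.inv_simple i, ← mul_inv_rev, cs.length_inv, cs.length_inv]; exact hi
  have h0 : ⟪R.e i, p⟫_ℝ = 0 := by
    by_contra hne
    have h1 := hu _ (R.isRoot_e i) (lt_of_le_of_ne (hp i) (Ne.symm hne))
    have h2 := R.inner_ρ_neg hi'
    rw [R.inner_σ_right] at h1
    linarith
  have hmem := ih (cs.length (cs.simple i * u)) hi (u := cs.simple i * u) (fun α hα hαp ↦ by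
    rw [R.σ_mul, ← R.inner_simple_left]
    refine hu _ (hα.map _) ?_
    rwa [R.inner_simple_left, R.simple_apply_eq_self h0]) rfl
  have hs : cs.simple i ∈ parabolic cs J := Subgroup.subset_closure ⟨i, hJ i h0, rfl⟩
  simpa using mul_mem hs hmem

variable [Finite W]

theorem exists_chamber {v : V} (hv : ∀ α, R.IsRoot α → ⟪α, v⟫_ℝ ≠ 0) :
    ∃ u : W, ∀ α, R.IsRoot α → 0 < ⟪α, R.σ u R.ρ⟫_ℝ → 0 < ⟪α, v⟫_ℝ := by
  obtain ⟨w, hw⟩ := Finite.exists_max fun w : W ↦ ⟪R.σ w v, R.ρ⟫_ℝ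
  have hdom : R.Dominant (R.σ w v) := by
    intro i
    obtain ⟨c, hc, hc'⟩ := R.exists_simple_apply i (R.σ w v)
    have h1 := hw (cs.simple i * w)
    rw [R.σ_mul, hc, inner_sub_left, real_inner_smul_left, R.inner_e_ρ] at h1
    have : 0 ≤ c * ⟪R.e i, R.e i⟫_ℝ := mul_nonneg (by linarith) real_inner_self_nonneg
    linarith
  refine ⟨w⁻¹, fun α hα hpos ↦ ?_⟩
  rw [R.inner_σ_right, inv_inv] at hpos
  have h1 := (hα.map w).inner_nonneg hpos hdom
  rw [(R.σ w).inner_map_map] at h1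
  exact lt_of_le_of_ne h1 (hv α hα).symm

theorem finite_roots : {α | R.IsRoot α}.Finite := by
  have : {α | R.IsRoot α} = Set.range fun x : W × I ↦ R.σ x.1 (R.e x.2) := by
    ext α
    exact ⟨fun ⟨w, i, h⟩ ↦ ⟨(w, i), h.symm⟩, fun ⟨⟨w, i⟩, h⟩ ↦ ⟨w, i, h.symm⟩⟩
  rw [this]
  exact Set.finite_range _

/-- The root arrangement with the isometry attached to `w`. -/
noncomputable def arrangement (w : W) : RootArrangement V where
  roots := R.finite_roots.toFinset
  g := (R.σ w).trans R.D.symm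
  zero_notMem h := by
    have h' : R.IsRoot 0 := by simpa using h
    exact h'.inner_ρ_ne_zero (inner_zero_left _)
  neg_mem α hα := by
    rw [Set.Finite.mem_toFinset] at hα ⊢
    exact IsRoot.neg hα
  reduced α hα β hβ c h := by
    rw [Set.Finite.mem_toFinset] at hα hβ
    exact IsRoot.eq_or_eq_neg hα hβ h
  map_mem α hα := by
    rw [Set.Finite.mem_toFinset] at hα ⊢
    exact (IsRoot.map hα w).symm_D

theorem mem_roots {w : W} {α : V} : α ∈ (R.arrangement w).roots ↔ R.IsRoot α := by
  rw [arrangement, Set.Finite.mem_toFinset]; rfl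

theorem g_apply (w : W) (x : V) : (R.arrangement w).g x = R.D.symm (R.σ w x) := rfl

theorem g_σ_ρ (w u : W) :
    (R.arrangement w).g (R.σ u R.ρ) = R.σ (δW.symm (w * u)) R.ρ := by
  rw [g_apply, ← R.σ_mul, R.D_symm_σ, R.D_symm_ρ]

theorem regular_σ_ρ (w u : W) : (R.arrangement w).Regular (R.σ u R.ρ) := by
  intro α hα
  rw [mem_roots] at hα
  rw [R.inner_σ_right]
  exact (hα.map _).inner_ρ_ne_zero

theorem d_σ_mul (w u v : W) :
    (R.arrangement w).d (R.σ u R.ρ) (R.σ (u * v) R.ρ) = cs.length v := by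
  classical
  induction hn : cs.length v generalizing v with
  | zero =>
    rw [cs.length_eq_zero_iff.1 hn, mul_one, RootArrangement.d, Finset.card_eq_zero,
      Finset.eq_empty_iff_forall_notMem]
    intro α hα
    rw [RootArrangement.mem_sep] at hα
    linarith [hα.2.1, hα.2.2]
  | succ n ih =>
    have hv1 : v ≠ 1 := by rintro rfl; simp at hn
    obtain ⟨i, hi⟩ := cs.exists_rightDescent_of_ne_one hv1
    rw [CoxeterSystem.isRightDescent_iff] at hi
    obtain ⟨v', hv⟩ : ∃ v', v = v' * cs.simple i :=
      ⟨v * cs.simple i, by rw [cs.simple_mul_simple_cancel_right]⟩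
    have hi : cs.length v' + 1 = cs.length v := by
      rw [← hi, hv, cs.simple_mul_simple_cancel_right]
    have ih' := ih v' (by lia)
    rw [← ih', RootArrangement.d, RootArrangement.d]
    have hpos : 0 < ⟪R.σ v' (R.e i), R.ρ⟫_ℝ := R.inner_ρ_pos (by rw [← hv]; lia)
    have hru : ⟪R.σ (u * v') (R.e i), R.σ u R.ρ⟫_ℝ = ⟪R.σ v' (R.e i), R.ρ⟫_ℝ := by
      rw [R.σ_mul, (R.σ u).inner_map_map]
    have hins : (R.arrangement w).sep (R.σ u R.ρ) (R.σ (u * v) R.ρ) =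
        insert (R.σ (u * v') (R.e i))
          ((R.arrangement w).sep (R.σ u R.ρ) (R.σ (u * v') R.ρ)) := by
      ext α
      rw [Finset.mem_insert, RootArrangement.mem_sep, RootArrangement.mem_sep, mem_roots]
      obtain ⟨β, rfl⟩ := (R.σ (u * v')).surjective α
      rw [(R.σ (u * v')).injective.eq_iff, hv, ← mul_assoc, R.σ_mul (u * v'),
        (R.σ (u * v')).inner_map_map, (R.σ (u * v')).inner_map_map, ← R.inner_simple_left]
      by_cases h1 : β = R.e i
      · subst h1
        simp only [true_or, iff_true]
        refine ⟨(R.isRoot_e i).map _, by rwa [hru], ?_⟩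
        rw [R.simple_e, inner_neg_left, R.inner_e_ρ]
        norm_num
      · simp only [h1, false_or]
        by_cases h2 : β = -R.e i
        · subst h2
          rw [map_neg, inner_neg_left, hru]
          constructor <;> (rintro ⟨-, h, -⟩; linarith)
        · constructor
          · rintro ⟨ha, hb, hc⟩
            have hβ : R.IsRoot β := by simpa [R.σ_inv_σ] using ha.map (u * v')⁻¹
            exact ⟨ha, hb, (hβ.simple_neg_iff h1 h2).1 hc⟩
          · rintro ⟨ha, hb, hc⟩
            have hβ : R.IsRoot β := by simpa [R.σ_inv_σ] using ha.map (u * v')⁻¹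
            exact ⟨ha, hb, (hβ.simple_neg_iff h1 h2).2 hc⟩
    rw [hins, Finset.card_insert_of_notMem]
    rw [RootArrangement.mem_sep, (R.σ (u * v')).inner_map_map, R.inner_e_ρ]
    rintro ⟨-, -, h⟩
    linarith

theorem d_σ (w u v : W) :
    (R.arrangement w).d (R.σ u R.ρ) (R.σ v R.ρ) = cs.length (u⁻¹ * v) := by
  rw [← R.d_σ_mul w u (u⁻¹ * v), mul_inv_cancel_left]

end Realization

end

section
open scoped InnerProductSpace

section Length
variable {I : Type*} {M : CoxeterMatrix I} {W : Type*} [Group W] (cs : CoxeterSystem M W)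

theorem length_map_le {δ : I → I} {f : W →* W} (hf : ∀ i, f (cs.simple i) = cs.simple (δ i))
    (w : W) : cs.length (f w) ≤ cs.length w := by
  obtain ⟨ω, hω, rfl⟩ := cs.exists_isReduced w
  have h : f (cs.wordProd ω) = cs.wordProd (ω.map δ) := by
    simp only [CoxeterSystem.wordProd, map_list_prod, List.map_map]
    congr 1
    exact List.map_congr_left fun i _ ↦ hf i
  rw [h, hω.eq]
  simpa using cs.length_wordProd_le (ω.map δ)

theorem length_map_eq {δ : I ≃ I} {δW : W ≃* W} (hδW : ∀ i, δW (cs.simple i) = cs.simple (δ i))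
    (w : W) : cs.length (δW w) = cs.length w := by
  refine le_antisymm (length_map_le cs (f := δW.toMonoidHom) hδW w) ?_
  have := length_map_le cs (f := δW.symm.toMonoidHom) (δ := δ.symm) (fun i ↦ by
    change δW.symm (cs.simple i) = _
    rw [MulEquiv.symm_apply_eq, hδW, Equiv.apply_symm_apply]) (δW w)
  simpa using this

theorem stepTo.symm {δ : I ≃ I} {J : Set I} {a b : W} (h : stepTo cs J δ a b)
    (hab : cs.length a ≤ cs.length b) : stepTo cs J δ b a := by
  obtain ⟨j, hj, rfl, -⟩ := h
  exact ⟨j, hj, by simp [mul_assoc], hab⟩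

theorem toRel.length_le_and_symm {δ : I ≃ I} {J : Set I} {a b : W} (h : toRel cs J δ a b) :
    cs.length b ≤ cs.length a ∧ (cs.length a ≤ cs.length b → toRel cs J δ b a) := by
  induction h with
  | refl => exact ⟨le_rfl, fun _ ↦ .refl⟩
  | tail _ hbc ih =>
    have hle : cs.length _ ≤ cs.length _ := hbc.choose_spec.2.2
    refine ⟨hle.trans ih.1, fun h ↦ ?_⟩
    have := ih.1
    exact .head (hbc.symm cs (by lia)) (ih.2 (by lia))

theorem elemStrong_self (J : Set I) (δW : W ≃* W) (w : W) : ElemStrong cs J δW w w :=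
  ⟨rfl, 1, one_mem _, by simp, by simp⟩

end Length

namespace Realization
variable {I : Type*} [Fintype I] {M : CoxeterMatrix I} {W : Type*} [Group W]
  {cs : CoxeterSystem M W} {δ : I ≃ I} {δW : W ≃* W}
  {V : Type*} [NormedAddCommGroup V] [InnerProductSpace ℝ V] (R : Realization cs δ δW V)

/-- `v` and `u • ρ` lie in the same chamber. -/
def InChamber (u : W) (v : V) : Prop :=
  ∀ α, R.IsRoot α → (0 < ⟪α, v⟫_ℝ ↔ 0 < ⟪α, R.σ u R.ρ⟫_ℝ)

theorem inChamber_self (u : W) : R.InChamber u (R.σ u R.ρ) := fun _ _ ↦ Iff.rfl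

variable [Finite W]

theorem exists_inChamber {w : W} {v : V} (hv : (R.arrangement w).Regular v) :
    ∃ u : W, R.InChamber u v := by
  obtain ⟨u, hu⟩ := R.exists_chamber (v := v) fun α hα ↦ hv α (R.mem_roots.2 hα)
  refine ⟨u, fun α hα ↦ ⟨fun h ↦ ?_, hu α hα⟩⟩
  by_contra hcon
  have hne : ⟪α, R.σ u R.ρ⟫_ℝ ≠ 0 := R.regular_σ_ρ w u α (R.mem_roots.2 hα)
  have hlt := lt_of_le_of_ne (not_lt.1 hcon) hne
  have := hu (-α) hα.neg (by rw [inner_neg_left]; linarith)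
  rw [inner_neg_left] at this
  linarith

variable {R}

theorem InChamber.regular {u : W} {v : V} (h : R.InChamber u v) (w : W) :
    (R.arrangement w).Regular v := by
  intro α hα h0
  rw [R.mem_roots] at hα
  have h1 := h α hα
  have h2 := h (-α) hα.neg
  rw [inner_neg_left, inner_neg_left, h0] at h2
  rw [h0] at h1
  have hne : ⟪α, R.σ u R.ρ⟫_ℝ ≠ 0 := R.regular_σ_ρ w u α (R.mem_roots.2 hα)
  rcases lt_or_gt_of_ne hne with h | h
  · simp at h2; linarith
  · simp at h1; linarith

theorem InChamber.d_eq {u u' : W} {v v' : V} (h : R.InChamber u v) (h' : R.InChamber u' v')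
    (w : W) : (R.arrangement w).d v v' = cs.length (u⁻¹ * u') := by
  rw [← R.d_σ w, RootArrangement.d, RootArrangement.d]
  congr 1
  ext α
  rw [RootArrangement.mem_sep, RootArrangement.mem_sep]
  refine and_congr_right fun hα ↦ ?_
  rw [(h'.regular w).neg_iff hα, (R.regular_σ_ρ w u').neg_iff hα]
  rw [R.mem_roots] at hα
  rw [h α hα, h' α hα]

theorem InChamber.unique {u u' : W} {v : V} (h : R.InChamber u v) (h' : R.InChamber u' v) :
    u = u' := by
  have h1 := h.d_eq h' 1
  have h2 := h.d_eq h 1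
  rw [h2, inv_mul_cancel, cs.length_one, eq_comm, cs.length_eq_zero_iff, inv_mul_eq_one] at h1
  exact h1

theorem InChamber.map {u : W} {v : V} (h : R.InChamber u v) (w : W) :
    R.InChamber (δW.symm (w * u)) ((R.arrangement w).g v) := by
  intro α hα
  rw [← R.g_σ_ρ, RootArrangement.inner_map_right, RootArrangement.inner_map_right]
  exact h _ (R.mem_roots.1 ((R.arrangement w).symm_mem (R.mem_roots.2 hα)))

theorem InChamber.d_map {u u' : W} {v v' : V} (h : R.InChamber u v) (h' : R.InChamber u' v')
    (hδW : ∀ i, δW (cs.simple i) = cs.simple (δ i)) (w : W) :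
    (R.arrangement w).d v ((R.arrangement w).g v') = cs.length (δW u⁻¹ * w * u') := by
  rw [h.d_eq (h'.map w) w, ← length_map_eq cs hδW, map_mul, MulEquiv.apply_symm_apply, mul_assoc]

variable (R)

theorem eq_of_σ_ρ_eq {u u' : W} (h : R.σ u R.ρ = R.σ u' R.ρ) : u = u' :=
  (h ▸ R.inChamber_self u : R.InChamber u (R.σ u' R.ρ)).unique (R.inChamber_self u')

theorem simple_mul_eq_mul_simple {w : W} {i j : I} {ε : ℝ} (hε : ε * ε = 1)
    (h : R.σ w (R.e j) = ε • R.e i) : cs.simple i * w = w * cs.simple j := by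
  refine R.eq_of_σ_ρ_eq ?_
  obtain ⟨c, hc, hc'⟩ := R.exists_simple_apply i (R.σ w R.ρ)
  obtain ⟨d, hd, hd'⟩ := R.exists_simple_apply j R.ρ
  rw [R.σ_mul, R.σ_mul, hc, hd, map_sub, map_smul, h, smul_smul]
  have h1 : ⟪R.e i, R.e i⟫_ℝ = ⟪R.e j, R.e j⟫_ℝ := by
    rw [← (R.σ w).inner_map_map (R.e j), h, real_inner_smul_left, real_inner_smul_right,
      ← mul_assoc, hε, one_mul]
  have h2 : ε * ⟪R.e i, R.σ w R.ρ⟫_ℝ = ⟪R.e j, R.ρ⟫_ℝ := by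
    rw [← (R.σ w).inner_map_map (R.e j), h, real_inner_smul_left]
  have h3 : ⟪R.e j, R.e j⟫_ℝ ≠ 0 := fun h0 ↦ R.e_ne_zero j (inner_self_eq_zero.1 h0)
  have h4 : c = d * ε := by
    apply mul_right_cancel₀ h3
    rw [h1] at hc'
    rw [hc']
    linear_combination (-ε) * hd' - 2 * ⟪R.e i, R.σ w R.ρ⟫_ℝ * hε + 2 * ε * h2
  rw [h4]

theorem elemStrong_of_step (R : Realization cs δ δW V)
    (hδW : ∀ i, δW (cs.simple i) = cs.simple (δ i)) {J : Set I} {j : I}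
    (hj : j ∈ J) {w : W} (hlen : cs.length w = cs.length (cs.simple (δ j) * w * cs.simple j)) :
    ElemStrong cs J δW w (cs.simple (δ j) * w * cs.simple j) := by
  by_cases h1 : cs.length w < cs.length (cs.simple (δ j) * w) ∨
      cs.length w < cs.length (w * cs.simple j)
  · refine ⟨hlen, cs.simple j, Subgroup.subset_closure ⟨j, hj, rfl⟩, ?_, ?_⟩
    · rw [hδW, cs.inv_simple]
    · rw [hδW, cs.inv_simple, cs.length_simple]
      rcases cs.length_mul_simple w j with h | h <;>
        rcases cs.length_simple_mul w (δ j) with h' | h' <;> lia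
  · push Not at h1
    obtain ⟨h1, h2⟩ := h1
    have h3 := cs.length_simple_mul_ne w (δ j)
    have h4 := cs.length_mul_simple_ne w j
    have hneg : ⟪R.σ w (R.e j), R.ρ⟫_ℝ < 0 := R.inner_ρ_neg (by lia)
    have hpos : 0 < ⟪R.σ (cs.simple (δ j)) (R.σ w (R.e j)), R.ρ⟫_ℝ := by
      rw [← R.σ_mul]
      exact R.inner_ρ_pos (by lia)
    have hroot : R.IsRoot (R.σ w (R.e j)) := (R.isRoot_e j).map w
    have hcomm : cs.simple (δ j) * w = w * cs.simple j := by
      by_cases h5 : R.σ w (R.e j) = R.e (δ j)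
      · exact R.simple_mul_eq_mul_simple (ε := 1) (by norm_num) (by rw [h5, one_smul])
      by_cases h6 : R.σ w (R.e j) = -R.e (δ j)
      · exact R.simple_mul_eq_mul_simple (ε := -1) (by norm_num) (by rw [h6, neg_one_smul])
      have := (hroot.simple_neg_iff h5 h6).2 hneg
      linarith
    rw [hcomm, cs.simple_mul_simple_cancel_right]
    exact elemStrong_self cs J δW w

end Realization

end

section
open scoped InnerProductSpace

namespace Realization

section Twist
variable {I : Type*} {M : CoxeterMatrix I} {W : Type*} [Group W]
  {cs : CoxeterSystem M W} {δ : I ≃ I} {δW : W ≃* W}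

/-- The twisted conjugate of `w` by `u⁻¹`. -/
def twist (δW : W ≃* W) (w u : W) : W := δW u⁻¹ * w * u

theorem twist_mem_orbit {J : Set I} {w u : W} (hu : u ∈ parabolic cs J) :
    twist δW w u ∈ orbit cs J δW w := ⟨u⁻¹, inv_mem hu, by rw [inv_inv]; rfl⟩

theorem twist_eq (w u u' : W) :
    twist δW w u' = δW (u'⁻¹ * u) * twist δW w u * (u'⁻¹ * u)⁻¹ := by
  simp only [twist, map_mul, mul_inv_rev, inv_inv, map_inv]
  group

theorem twist_mul_simple (hδW : ∀ i, δW (cs.simple i) = cs.simple (δ i)) (w u : W) (j : I) :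
    twist δW w (u * cs.simple j) = cs.simple (δ j) * twist δW w u * cs.simple j := by
  simp only [twist, mul_inv_rev, cs.inv_simple, map_mul, hδW, mul_assoc]

end Twist

variable {I : Type*} [Fintype I] {M : CoxeterMatrix I} {W : Type*} [Group W]
  {cs : CoxeterSystem M W} {δ : I ≃ I} {δW : W ≃* W}
  {V : Type*} [NormedAddCommGroup V] [InnerProductSpace ℝ V] (R : Realization cs δ δW V)

/-- A dominant vector orthogonal to exactly the simple roots indexed by `J`. -/
def IsFacet (J : Set I) (p : V) : Prop := R.Dominant p ∧ ∀ i, ⟪R.e i, p⟫_ℝ = 0 ↔ i ∈ J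

theorem exists_isFacet (J : Set I) : ∃ p, R.IsFacet J p := by
  classical
  obtain ⟨p, hp⟩ := R.exists_inner fun i ↦ if i ∈ J then 0 else 1
  refine ⟨p, fun i ↦ ?_, fun i ↦ ?_⟩
  · rw [hp]; split <;> norm_num
  · rw [hp]; split <;> simp_all

theorem eq_or_eq_mul_simple (R : Realization cs δ δW V) {J : Set I} {u u' : W}
    (hu : u ∈ parabolic cs J) (hu' : u' ∈ parabolic cs J) (h : cs.length (u⁻¹ * u') ≤ 1) :
    u' = u ∨ ∃ j ∈ J, u' = u * cs.simple j := by
  rcases Nat.le_one_iff_eq_zero_or_eq_one.1 h with h | h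
  · left
    rw [cs.length_eq_zero_iff, inv_mul_eq_one] at h
    exact h.symm
  · right
    obtain ⟨j, hj⟩ := cs.length_eq_one_iff.1 h
    exact ⟨j, R.mem_of_simple_mem_parabolic (hj ▸ mul_mem (inv_mem hu) hu'),
      by rw [← hj, mul_inv_cancel_left]⟩

variable {R} in
theorem inner_ρ_pos_of_mem_minRight {J : Set I} {p : V} (hp : R.IsFacet J p) {y : W}
    (hy : y ∈ minRight cs J) {α : V} (hα : R.IsRoot α) (hαp : ⟪α, p⟫_ℝ = 0)
    (hpos : 0 < ⟪α, R.ρ⟫_ℝ) : 0 < ⟪R.σ y α, R.ρ⟫_ℝ := by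
  obtain ⟨a, ha, hsum⟩ := hα.exists_sum hpos
  have h0 : ∑ j, a j * ⟪R.e j, p⟫_ℝ = 0 := by
    rw [← hαp, hsum, sum_inner]
    exact Finset.sum_congr rfl fun j _ ↦ (real_inner_smul_left _ _ _).symm
  rw [Finset.sum_eq_zero_iff_of_nonneg fun j _ ↦ mul_nonneg (ha j) (hp.1 j)] at h0
  refine lt_of_le_of_ne ?_ (hα.map y).inner_ρ_ne_zero.symm
  rw [hsum, map_sum, sum_inner]
  refine Finset.sum_nonneg fun j hj ↦ ?_
  rw [map_smul, real_inner_smul_left]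
  rcases mul_eq_zero.1 (h0 j hj) with h | h
  · rw [h, zero_mul]
  · exact mul_nonneg (ha j) (R.inner_ρ_pos (hy j ((hp.2 j).1 h))).le

variable [Finite W]

theorem star_ρ {p : V} (hp : R.Dominant p) (w : W) : (R.arrangement w).Star p R.ρ := by
  refine ⟨by simpa using R.regular_σ_ρ w 1, fun α hα hpos ↦ ?_⟩
  rw [R.mem_roots] at hα
  by_contra hcon
  have := hα.neg.inner_nonneg (p := p)
    (by rw [inner_neg_left]; linarith [lt_of_le_of_ne (not_lt.1 hcon) hα.inner_ρ_ne_zero]) hp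
  rw [inner_neg_left] at this
  linarith

theorem dominant_of_star {p : V} {w : W} (h : (R.arrangement w).Star p R.ρ) : R.Dominant p := by
  intro i
  by_contra hcon
  have := h.neg _ (R.mem_roots.2 (R.isRoot_e i)) (not_le.1 hcon)
  rw [R.inner_e_ρ] at this
  linarith

theorem star_σ_ρ {p : V} {w u : W} (h : (R.arrangement w).Star p R.ρ) (hu : R.σ u p = p) :
    (R.arrangement w).Star p (R.σ u R.ρ) := by
  refine ⟨R.regular_σ_ρ w u, fun α hα hpos ↦ ?_⟩
  rw [R.mem_roots] at hα
  rw [R.inner_σ_right]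
  refine h.2 _ (R.mem_roots.2 (hα.map _)) ?_
  rwa [R.inner_σ_left, inv_inv, hu]

variable {R}

theorem InChamber.mem_parabolic {p v : V} {w u : W} (hu : R.InChamber u v) (hp : R.Dominant p)
    (hv : (R.arrangement w).Star p v) {J : Set I} (hJ : ∀ i, ⟪R.e i, p⟫_ℝ = 0 → i ∈ J) :
    u ∈ parabolic cs J :=
  R.mem_parabolic_of_pos hp hJ fun α hα hpos ↦
    (hu α hα).1 (hv.2 α (R.mem_roots.2 hα) hpos)

theorem InChamber.len_eq (hδW : ∀ i, δW (cs.simple i) = cs.simple (δ i)) {u : W} {v : V}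
    (hu : R.InChamber u v) (w : W) :
    (R.arrangement w).len v = cs.length (twist δW w u) := by
  rw [RootArrangement.len, hu.d_map hu hδW, twist]

theorem isMin_of_inChamber (hδW : ∀ i, δW (cs.simple i) = cs.simple (δ i)) {J : Set I} {p : V}
    (hp : R.IsFacet J p) {w u : W} (hu : u ∈ parabolic cs J)
    (hmin : ∀ y ∈ orbit cs J δW w, cs.length (twist δW w u) ≤ cs.length y) :
    (R.arrangement w).IsMin p (R.σ u R.ρ) := by
  refine ⟨R.star_σ_ρ (R.star_ρ hp.1 w)
    (R.parabolic_apply_eq_self (fun j hj ↦ (hp.2 j).2 hj) hu), fun v hv ↦ ?_⟩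
  obtain ⟨u', hu'⟩ := R.exists_inChamber hv.1
  rw [(R.inChamber_self u).len_eq hδW, hu'.len_eq hδW]
  exact hmin _ (twist_mem_orbit (hu'.mem_parabolic hp.1 hv fun i ↦ (hp.2 i).1))

/-- Paths of chambers translate into paths of twisted conjugates. -/
theorem reflTransGen_twist {w : W} {r : V → V → Prop} {s : W → W → Prop}
    (hr : ∀ v v', r v v' → (R.arrangement w).Regular v')
    (hrs : ∀ v v' u u', R.InChamber u v → R.InChamber u' v' → r v v' →
      Relation.ReflTransGen s (twist δW w u) (twist δW w u'))
    {v v' : V} (h : Relation.ReflTransGen r v v') {u u' : W} (hu : R.InChamber u v)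
    (hu' : R.InChamber u' v') :
    Relation.ReflTransGen s (twist δW w u) (twist δW w u') := by
  induction h generalizing u' with
  | refl => rw [hu.unique hu']
  | tail hab hbc ih =>
    obtain ⟨u₁, hu₁⟩ : ∃ u₁, R.InChamber u₁ _ := by
      rcases hab.cases_tail with rfl | ⟨c, -, hc⟩
      · exact ⟨u, hu⟩
      · exact R.exists_inChamber (hr _ _ hc)
    exact (ih hu₁).trans (hrs _ _ _ _ hu₁ hu' hbc)

theorem elemStrong_of_elem (hδW : ∀ i, δW (cs.simple i) = cs.simple (δ i)) {J : Set I} {p : V}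
    (hp : R.IsFacet J p) {w u u' : W} {v v' : V} (hu : R.InChamber u v) (hu' : R.InChamber u' v')
    (h : (R.arrangement w).Elem p v v') :
    ElemStrong cs J δW (twist δW w u) (twist δW w u') := by
  obtain ⟨hv, hv', hlen, h⟩ := h
  have huJ := hu.mem_parabolic hp.1 hv fun i ↦ (hp.2 i).1
  have huJ' := hu'.mem_parabolic hp.1 hv' fun i ↦ (hp.2 i).1
  rw [hu.len_eq hδW, hu'.len_eq hδW] at hlen
  have hinv : cs.length (u'⁻¹ * u) = cs.length (u⁻¹ * u') := by
    rw [← cs.length_inv, mul_inv_rev, inv_inv]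
  rcases h with h | h | h
  · rw [hu.d_eq hu'] at h
    rcases R.eq_or_eq_mul_simple huJ huJ' h with rfl | ⟨j, hj, rfl⟩
    · exact elemStrong_self cs J δW _
    · rw [twist_mul_simple hδW] at hlen ⊢
      exact R.elemStrong_of_step hδW hj hlen
  · refine ⟨hlen, u'⁻¹ * u, mul_mem (inv_mem huJ') huJ, twist_eq w u u', Or.inr ?_⟩
    rw [hu.d_map hu' hδW, hu.len_eq hδW, hu.d_eq hu', ← hinv] at h
    rw [add_comm, ← h]
    congr 1
    simp [twist, mul_assoc]
  · refine ⟨hlen, u'⁻¹ * u, mul_mem (inv_mem huJ') huJ, twist_eq w u u', Or.inl ?_⟩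
    rw [hu'.d_map hu hδW, hu'.len_eq hδW, hu'.d_eq hu, ← hlen] at h
    rw [add_comm, ← h]
    congr 1
    simp [twist, mul_assoc]

theorem simRel_twist [FiniteDimensional ℝ V] (R : Realization cs δ δW V)
    (hδW : ∀ i, δW (cs.simple i) = cs.simple (δ i)) {J : Set I} {w u u' : W}
    (hu : u ∈ parabolic cs J) (hu' : u' ∈ parabolic cs J)
    (hmin : ∀ y ∈ orbit cs J δW w, cs.length (twist δW w u) ≤ cs.length y)
    (hmin' : ∀ y ∈ orbit cs J δW w, cs.length (twist δW w u') ≤ cs.length y) :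
    simRel cs J δW (twist δW w u) (twist δW w u') := by
  obtain ⟨p, hp⟩ := R.exists_isFacet J
  refine reflTransGen_twist (fun v v' h ↦ h.2.1.1)
    (fun v v' u u' hu hu' h ↦ .single (elemStrong_of_elem hδW hp hu hu' h))
    (RootArrangement.rel_of_isMin (isMin_of_inChamber hδW hp hu hmin)
      (isMin_of_inChamber hδW hp hu' hmin')) (R.inChamber_self u) (R.inChamber_self u')

theorem toRel_of_cyc (hδW : ∀ i, δW (cs.simple i) = cs.simple (δ i)) {J : Set I} {p : V}
    (hp : R.IsFacet J p) {w u u' : W} {v v' : V} (hu : R.InChamber u v) (hu' : R.InChamber u' v')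
    (h : (R.arrangement w).Cyc p v v') : toRel cs J δ (twist δW w u) (twist δW w u') := by
  obtain ⟨hv, hv', h, hlen⟩ := h
  have huJ := hu.mem_parabolic hp.1 hv fun i ↦ (hp.2 i).1
  have huJ' := hu'.mem_parabolic hp.1 hv' fun i ↦ (hp.2 i).1
  rw [hu.len_eq hδW, hu'.len_eq hδW] at hlen
  rw [hu.d_eq hu'] at h
  rcases R.eq_or_eq_mul_simple huJ huJ' h with rfl | ⟨j, hj, rfl⟩
  · exact .refl
  · exact .single ⟨j, hj, twist_mul_simple hδW w u j, hlen⟩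

theorem twist_eq_self_of_signs {y u : W} {q v : V} (hs : (R.arrangement y).Stable q)
    (hρ : (R.arrangement y).Star q R.ρ) (hv : (R.arrangement y).Star q v) (hu : R.InChamber u v)
    (h1 : ∀ α ∈ (R.arrangement y).rootsAt q,
      0 < ⟪α, (R.arrangement y).g R.ρ⟫_ℝ ↔ 0 < ⟪α, R.ρ⟫_ℝ)
    (h2 : ∀ α ∈ (R.arrangement y).rootsAt q,
      0 < ⟪α, (R.arrangement y).g v⟫_ℝ ↔ 0 < ⟪α, v⟫_ℝ) :
    twist δW y u = y := by
  set A := R.arrangement y with hA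
  have hq := R.dominant_of_star hρ
  have huJ : u ∈ parabolic cs {i | ⟪R.e i, q⟫_ℝ = 0} := hu.mem_parabolic hq hv fun i hi ↦ hi
  have huq : R.σ u q = q := R.parabolic_apply_eq_self (fun j hj ↦ hj) huJ
  have huq' : R.σ u⁻¹ q = q := R.parabolic_apply_eq_self (fun j hj ↦ hj) (inv_mem huJ)
  have hugq : R.σ u (A.g.symm q) = A.g.symm q := by
    refine R.parabolic_apply_eq_self (fun j hj ↦ ?_) huJ
    rw [A.inner_symm_right]
    exact (RootArrangement.mem_rootsAt.1 (hs _ (RootArrangement.mem_rootsAt.2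
      ⟨R.mem_roots.2 (R.isRoot_e j), hj⟩))).2
  have hyρ : A.g.symm R.ρ = R.σ y⁻¹ R.ρ := by
    rw [LinearIsometryEquiv.symm_apply_eq, R.g_apply, R.σ_σ_inv, R.D_symm_ρ]
  set t := δW.symm (y * (u * y⁻¹)) with ht
  have htρ : ∀ α, ⟪α, R.σ t R.ρ⟫_ℝ = ⟪A.g (R.σ u⁻¹ (A.g.symm α)), R.ρ⟫_ℝ := by
    intro α
    rw [ht, ← R.g_σ_ρ, R.σ_mul, ← hyρ, A.inner_map_right, R.inner_σ_right, A.inner_symm_right]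
  have hcham : R.InChamber t (R.σ u R.ρ) := by
    intro α hα
    have hαA : α ∈ A.roots := R.mem_roots.2 hα
    rw [htρ]
    by_cases h0 : ⟪α, q⟫_ℝ = 0
    · have hαq : α ∈ A.rootsAt q := RootArrangement.mem_rootsAt.2 ⟨hαA, h0⟩
      have hgα := hs.symm hαq
      have hugα : R.σ u⁻¹ (A.g.symm α) ∈ A.rootsAt q := by
        rw [RootArrangement.mem_rootsAt] at hgα ⊢
        refine ⟨R.mem_roots.2 ((R.mem_roots.1 hgα.1).map _), ?_⟩
        rw [R.inner_σ_left, inv_inv, huq, hgα.2]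
      rw [← h1 _ (hs _ hugα), A.g.inner_map_map, ← R.inner_σ_right,
        ← hu _ (R.mem_roots.1 (RootArrangement.mem_rootsAt.1 hgα).1), ← A.inner_map_right,
        h2 _ hαq, hu _ hα]
    · have hβ : ⟪A.g (R.σ u⁻¹ (A.g.symm α)), q⟫_ℝ = ⟪α, q⟫_ℝ := by
        rw [← A.inner_symm_right, R.inner_σ_left, inv_inv, hugq, A.inner_symm_right,
          LinearIsometryEquiv.apply_symm_apply]
      rw [hρ.pos_iff (A.map_mem _ (R.mem_roots.2
          ((R.mem_roots.1 (A.symm_mem hαA)).map _))) (by rwa [hβ]), hβ,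
        (R.star_σ_ρ hρ huq).pos_iff hαA h0]
  have htu := hcham.unique (R.inChamber_self u)
  have : δW u = y * (u * y⁻¹) := by
    have h := congrArg δW htu
    rw [ht, MulEquiv.apply_symm_apply] at h
    exact h.symm
  rw [twist, map_inv, this]
  group

theorem toRel_of_mem_minRight (R : Realization cs δ δW V)
    (hδW : ∀ i, δW (cs.simple i) = cs.simple (δ i)) {J : Set I} {y u : W}
    (hy : y ∈ minRight cs J) (hu : u ∈ parabolic cs J)
    (hmin : ∀ x ∈ orbit cs J δW y, cs.length (twist δW y u) ≤ cs.length x) :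
    toRel cs J δ (twist δW y u) y := by
  obtain ⟨p, hp⟩ := R.exists_isFacet J
  have hzp : ∀ α ∈ (R.arrangement y).rootsAt p, 0 < ⟪α, (R.arrangement y).g.symm R.ρ⟫_ℝ →
      0 < ⟪α, R.ρ⟫_ℝ := by
    intro α hα hpos
    obtain ⟨hα, hαp⟩ := RootArrangement.mem_rootsAt.1 hα
    rw [R.mem_roots] at hα
    have hgα : ⟪(R.arrangement y).g α, R.ρ⟫_ℝ = ⟪R.σ y α, R.ρ⟫_ℝ := by
      rw [R.g_apply, ← R.D.inner_map_map, LinearIsometryEquiv.apply_symm_apply, R.D_ρ]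
    rw [RootArrangement.inner_symm_right, hgα] at hpos
    by_contra hcon
    have := inner_ρ_pos_of_mem_minRight hp hy hα.neg (by rw [inner_neg_left, hαp, neg_zero])
      (by rw [inner_neg_left]; linarith [lt_of_le_of_ne (not_lt.1 hcon) hα.inner_ρ_ne_zero])
    rw [map_neg, inner_neg_left] at this
    linarith
  obtain ⟨q, v', hs, -, hqz, hqv, hcyc, h1, h2⟩ :=
    RootArrangement.exists_cyc_stable_of_isMin (R.star_ρ hp.1 y) hzp
      (isMin_of_inChamber hδW hp hu hmin)
  obtain ⟨u₁, hu₁⟩ := R.exists_inChamber hqv.1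
  have := reflTransGen_twist (s := stepTo cs J δ) (fun v v' h ↦ h.2.1.1)
    (fun v v' u u' hu hu' h ↦ toRel_of_cyc hδW hp hu hu' h) hcyc (R.inChamber_self u) hu₁
  rwa [twist_eq_self_of_signs hs hqz hqv hu₁ h1 h2] at this

end Realization

end

end HePaper

namespace HePaper

variable {I : Type*} {M : CoxeterMatrix I} {W : Type*} [Group W]

/-- minimal length elements of a `W_J`-orbit are strongly `(J,δ)`-conjugate;
if moreover the orbit meets `W^J`, they are in the same `(J,δ)`-cyclic shift. -/
theorem min_length_strongly_conjugate
    [Fintype I] [Finite W]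
    (cs : CoxeterSystem M W) (J : Set I) (δ : I ≃ I)
    (hδM : ∀ i j : I, M (δ i) (δ j) = M i j)
    (δW : W ≃* W) (hδW : ∀ i : I, δW (cs.simple i) = cs.simple (δ i))
    (w w' : W) (hmem : w' ∈ orbit cs J δW w)
    (hwmin : ∀ u ∈ orbit cs J δW w, cs.length w ≤ cs.length u)
    (hw'min : ∀ u ∈ orbit cs J δW w, cs.length w' ≤ cs.length u) :
    simRel cs J δW w w' ∧
      ((orbit cs J δW w ∩ minRight cs J).Nonempty →
        simRel cs J δW w w' ∧ toRel cs J δ w w') := by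
  obtain ⟨V, _, _, _, ⟨R⟩⟩ := exists_realization cs δ hδM δW hδW
  obtain ⟨z, hz, rfl⟩ := hmem
  have h1 : Realization.twist δW w 1 = w := by simp [Realization.twist]
  have hz' : Realization.twist δW w z⁻¹ = δW z * w * z⁻¹ := by simp [Realization.twist]
  have hsim : simRel cs J δW w (δW z * w * z⁻¹) := by
    have := R.simRel_twist hδW (w := w) (one_mem (parabolic cs J)) (inv_mem hz)
      (by rwa [h1]) (by rwa [hz'])
    rwa [h1, hz'] at this
  refine ⟨hsim, ?_⟩
  rintro ⟨y, ⟨x, hx, rfl⟩, hy⟩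
  refine ⟨hsim, ?_⟩
  have horb : ∀ u ∈ orbit cs J δW (δW x * w * x⁻¹), u ∈ orbit cs J δW w := by
    rintro _ ⟨a, ha, rfl⟩
    exact ⟨a * x, mul_mem ha hx, by simp [mul_assoc]⟩
  have hyw : Realization.twist δW (δW x * w * x⁻¹) x = w := by
    simp [Realization.twist, mul_assoc]
  have hyw' : Realization.twist δW (δW x * w * x⁻¹) (x * z⁻¹) = δW z * w * z⁻¹ := by
    simp [Realization.twist, mul_assoc]
  have t1 := R.toRel_of_mem_minRight hδW hy hx (by rw [hyw]; exact fun u hu ↦ hwmin u (horb u hu))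
  have t2 := R.toRel_of_mem_minRight hδW hy (mul_mem hx (inv_mem hz))
    (by rw [hyw']; exact fun u hu ↦ hw'min u (horb u hu))
  rw [hyw] at t1
  rw [hyw'] at t2
  exact t1.trans (t2.length_le_and_symm.2 (hw'min _ ⟨x, hx, rfl⟩))

end HePaper
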